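/- arXiv:2602.16028 — 4 statements merged into one kernel-verified Lean document; each statement's English description precedes it below -/
import Mathlib

section
/- For every integer n ≥ 3 there is a constant c(n) depending only on n with the following property: for every canonical partially observable Markov chain M = (Ω, P) with |Ω| = n and all states a, b ∈ Ω such that Q := AQC_M(a,b) is finite and Q ≥ 2, one has NAQC_M(a,b) ≤ c(n) · (Q · log Q)^{2(n−2)}. -/
open Finset
open scoped ENNReal

/-- A canonical partially observable Markov chain: a finite state space with a
distinguished absorbing sink state; `P x y` is the probability of moving from `x` to `y`. -/
structure Canonical (Ω : Type) [Fintype Ω] [DecidableEq Ω] where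
  P : Ω → Ω → ℝ
  sink : Ω
  nonneg : ∀ x y, 0 ≤ P x y
  sum_one : ∀ x, ∑ y, P x y = 1
  sink_absorb : P sink sink = 1

variable {Ω : Type} [Fintype Ω] [DecidableEq Ω]

/-- Observation: `true` iff the state is the sink. -/
def Canonical.obs (M : Canonical Ω) (x : Ω) : Bool := decide (x = M.sink)

/-- The observation history `Z₀, …, Z_t` of a state trajectory `g`. -/
def obsHist (M : Canonical Ω) (g : ℕ → Ω) (t : ℕ) : List Bool :=
  (List.range (t + 1)).map fun i => M.obs (g i)

/-- Probability of the state trajectory `g` (conditionally on its initial state `g 0`)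
under rewinding strategy `A`, for `T` steps: at each time `t`, the next state `g (t+1)` is
drawn from the state at time `t - A(Z₀,…,Z_t)` (truncated subtraction realizes `max 0 _`). -/
noncomputable def trajProb (M : Canonical Ω) (A : List Bool → ℕ) (T : ℕ) (g : ℕ → Ω) : ℝ :=
  ∏ t ∈ Finset.range T, M.P (g (t - A (obsHist M g t))) (g (t + 1))

/-- Extend `f : Fin (T+1) → Ω` to `ℕ → Ω` by clamping. -/
def extendTraj {Ω : Type} (T : ℕ) (f : Fin (T + 1) → Ω) : ℕ → Ω :=
  fun n => f ⟨min n T, Nat.lt_succ_of_le (min_le_right n T)⟩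

/-- The probability that the chain `M` with rewinding strategy `A`, started at `x`,
produces the observation sequence `z = (Z₀, …, Z_T)`.  This is the distribution `D_T^{A,x}`. -/
noncomputable def obsSeqProb (M : Canonical Ω) (A : List Bool → ℕ) (x : Ω) (T : ℕ)
    (z : Fin (T + 1) → Bool) : ℝ :=
  ∑ f : Fin (T + 1) → Ω,
    if f 0 = x ∧ (∀ i, M.obs (f i) = z i) then trajProb M A T (extendTraj T f) else 0

/-- Total variation distance between the observation-sequence distributions
`D_T^{A,a}` and `D_T^{A,b}`. -/
noncomputable def obsTV (M : Canonical Ω) (A : List Bool → ℕ) (a b : Ω) (T : ℕ) : ℝ :=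
  (1 / 2) * ∑ z : Fin (T + 1) → Bool, |obsSeqProb M A a T z - obsSeqProb M A b T z|

/-- A rewinding strategy is non-adaptive if it depends only on the length of the history. -/
def NonAdaptive (A : List Bool → ℕ) : Prop :=
  ∀ l₁ l₂ : List Bool, l₁.length = l₂.length → A l₁ = A l₂

/-- Query complexity `QC^A_M(a,b)`: the least `T` with `d_TV(D_T^{A,a}, D_T^{A,b}) ≥ 1/3`,
as an element of `ℝ≥0∞` (`⊤` if no such `T` exists). -/
noncomputable def QC (M : Canonical Ω) (A : List Bool → ℕ) (a b : Ω) : ℝ≥0∞ :=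
  sInf {x : ℝ≥0∞ | ∃ T : ℕ, x = (T : ℝ≥0∞) ∧ 1 / 3 ≤ obsTV M A a b T}

/-- Adaptive query complexity: infimum over all rewinding strategies. -/
noncomputable def AQC (M : Canonical Ω) (a b : Ω) : ℝ≥0∞ :=
  ⨅ A : List Bool → ℕ, QC M A a b

/-- Non-adaptive query complexity: infimum over all non-adaptive rewinding strategies. -/
noncomputable def NAQC (M : Canonical Ω) (a b : Ω) : ℝ≥0∞ :=
  ⨅ A : {A : List Bool → ℕ // NonAdaptive A}, QC M A.1 a b

namespace Rewinding

/-- Number of queries of the depth-`i` tree in which every internal node has `N` children. -/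
def treeSteps (N : ℕ) : ℕ → ℕ
  | 0 => 0
  | i + 1 => N * (treeSteps N i + 1)

/-- Index of the parent of node `t + 1` when the nodes of the depth-`i` tree of arity `N` are
listed in preorder. -/
def treeParent (N : ℕ) : ℕ → ℕ → ℕ
  | 0, _ => 0
  | i + 1, t =>
    if t % (treeSteps N i + 1) = 0 then 0
    else 1 + t / (treeSteps N i + 1) * (treeSteps N i + 1)
      + treeParent N i (t % (treeSteps N i + 1) - 1)

lemma treeParent_le (N i t : ℕ) : treeParent N i t ≤ t := by
  induction i generalizing t with
  | zero => simp [treeParent]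
  | succ i ih =>
    unfold treeParent
    split_ifs with h
    · exact Nat.zero_le _
    · have h1 := ih (t % (treeSteps N i + 1) - 1)
      have h2 := Nat.div_add_mod' t (treeSteps N i + 1)
      omega

lemma treeSteps_add_one_le (N i : ℕ) : treeSteps N i + 1 ≤ (N + 1) ^ i := by
  induction i with
  | zero => simp [treeSteps]
  | succ i ih =>
    have h1 : 1 ≤ (N + 1) ^ i := Nat.one_le_pow _ _ (Nat.succ_pos _)
    have h2 := Nat.mul_le_mul_left N ih
    rw [treeSteps, pow_succ]
    nlinarith

/-- The non-adaptive strategy that explores the depth-`i` tree of arity `N`. -/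
def treeStrategy (N i : ℕ) (l : List Bool) : ℕ :=
  (l.length - 1) - treeParent N i (l.length - 1)

lemma nonAdaptive_treeStrategy (N i : ℕ) : NonAdaptive (treeStrategy N i) := by
  intro l₁ l₂ h
  simp [treeStrategy, h]

/-- Probability of the states of the depth-`i` tree of arity `N`, listed in preorder. -/
noncomputable def treeProb (M : Canonical Ω) (N i : ℕ) (g : ℕ → Ω) : ℝ :=
  ∏ t ∈ range (treeSteps N i), M.P (g (treeParent N i t)) (g (t + 1))

lemma trajProb_treeStrategy (M : Canonical Ω) (N i : ℕ) (g : ℕ → Ω) :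
    trajProb M (treeStrategy N i) (treeSteps N i) g = treeProb M N i g := by
  refine prod_congr rfl fun t _ => ?_
  have h := treeParent_le N i t
  have h1 : t - treeStrategy N i (obsHist M g t) = treeParent N i t := by
    simp only [treeStrategy, obsHist, List.length_map, List.length_range,
      Nat.add_sub_cancel]
    omega
  rw [h1]

lemma treeProb_congr (M : Canonical Ω) (N i : ℕ) {g g' : ℕ → Ω}
    (h : ∀ m ≤ treeSteps N i, g m = g' m) : treeProb M N i g = treeProb M N i g' := by
  refine prod_congr rfl fun t ht => ?_
  have ht := mem_range.1 ht
  rw [h _ ((treeParent_le N i t).trans ht.le), h _ ht]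

lemma treeProb_succ (M : Canonical Ω) (N i : ℕ) (g : ℕ → Ω) :
    treeProb M N (i + 1) g = ∏ j : Fin N,
      (M.P (g 0) (g (1 + j * (treeSteps N i + 1))) *
        treeProb M N i fun m => g (1 + j * (treeSteps N i + 1) + m)) := by
  unfold treeProb
  rw [treeSteps, ← Fin.prod_univ_eq_prod_range
      (fun t => M.P (g (treeParent N (i + 1) t)) (g (t + 1))),
    ← finProdFinEquiv.prod_comp, Fintype.prod_prod_type]
  refine prod_congr rfl fun j _ => ?_
  set L := treeSteps N i + 1 with hL
  simp only [finProdFinEquiv_apply_val]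
  rw [Fin.prod_univ_eq_prod_range
    (fun e => M.P (g (treeParent N (i + 1) (e + L * j))) (g (e + L * j + 1))) L, hL,
    prod_range_succ', ← hL, mul_comm]
  congr 1
  · congr 2
    · simp [treeParent, ← hL]
    · ring
  · refine prod_congr rfl fun e he => ?_
    have he := mem_range.1 he
    have hm : (e + 1 + L * (j : ℕ)) % L = e + 1 := by
      rw [Nat.add_mul_mod_self_left, Nat.mod_eq_of_lt (by omega)]
    have hd : (e + 1 + L * (j : ℕ)) / L = j := by
      rw [Nat.add_mul_div_left _ _ (by omega), Nat.div_eq_of_lt (by omega), zero_add]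
    congr 2
    · simp [treeParent, ← hL, hm, hd]
    · ring

/-- The function on `Fin (N * L + 1)` made of a root value and `N` blocks of length `L`. -/
def joinBlocks {α : Type*} {N L : ℕ} (x : α) (h : Fin N → Fin L → α) : Fin (N * L + 1) → α :=
  Fin.cons x fun k => h k.divNat k.modNat

lemma sum_joinBlocks {α : Type*} [Fintype α] {N L : ℕ} (F : (Fin (N * L + 1) → α) → ℝ) :
    ∑ f, F f = ∑ x : α, ∑ h : Fin N → Fin L → α, F (joinBlocks x h) := by
  classical
  rw [← (Fin.consEquiv fun _ : Fin (N * L + 1) => α).sum_comp, Fintype.sum_prod_type]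
  refine sum_congr rfl fun x _ => ?_
  rw [← ((Equiv.curry (Fin N) (Fin L) α).symm.trans
    (Equiv.arrowCongr finProdFinEquiv (Equiv.refl α))).sum_comp]
  rfl

lemma joinBlocks_zero {α : Type*} {N L : ℕ} (x : α) (h : Fin N → Fin L → α) :
    joinBlocks x h 0 = x := rfl

lemma joinBlocks_apply {α : Type*} {N L : ℕ} (x : α) (h : Fin N → Fin L → α) (j : Fin N)
    (e : Fin L) : joinBlocks x h (finProdFinEquiv (j, e)).succ = h j e := by
  have h1 := finProdFinEquiv.symm_apply_apply (j, e)
  rw [finProdFinEquiv_symm_apply, Prod.mk.injEq] at h1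
  simp [joinBlocks, h1.1, h1.2]

lemma forall_joinBlocks {N L : ℕ} {p : Fin (N * L + 1) → Prop} :
    (∀ k, p k) ↔ p 0 ∧ ∀ (j : Fin N) (e : Fin L), p (finProdFinEquiv (j, e)).succ := by
  rw [Fin.forall_fin_succ]
  refine and_congr_right fun _ => ⟨fun h j e => h _, fun h k => ?_⟩
  rw [← finProdFinEquiv.apply_symm_apply k]
  exact h _ _

/-- Law of the observations in the depth-`i` tree of arity `N` rooted at `x`. -/
noncomputable def treeLaw (M : Canonical Ω) (N i : ℕ) (x : Ω)
    (z : Fin (treeSteps N i + 1) → Bool) : ℝ :=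
  obsSeqProb M (treeStrategy N i) x (treeSteps N i) z

lemma treeLaw_zero (M : Canonical Ω) (N : ℕ) (x : Ω) (z : Fin (treeSteps N 0 + 1) → Bool) :
    treeLaw M N 0 x z = if M.obs x = z 0 then 1 else 0 := by
  unfold treeLaw obsSeqProb
  simp only [trajProb_treeStrategy]
  refine (sum_eq_single (fun _ => x) (fun f _ hf => if_neg fun h => hf ?_) (by simp)).trans ?_
  · funext i
    rw [show i = 0 from Subsingleton.elim (α := Fin 1) i 0]
    exact h.1
  · simp only [treeProb, treeSteps, range_zero, prod_empty]
    by_cases h : M.obs x = z 0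
    · rw [if_pos h]
      refine if_pos ⟨rfl, fun i => ?_⟩
      rw [show i = 0 from Subsingleton.elim (α := Fin 1) i 0]
      exact h
    · rw [if_neg h]
      exact if_neg fun hz => h (hz.2 0)

/-- Law of the observations in a depth-`i` subtree hanging below `x`. -/
noncomputable def branchLaw (M : Canonical Ω) (N i : ℕ) (x : Ω)
    (w : Fin (treeSteps N i + 1) → Bool) : ℝ :=
  ∑ y, M.P x y * treeLaw M N i y w

lemma treeLaw_succ (M : Canonical Ω) (N i : ℕ) (x : Ω) (b : Bool)
    (w : Fin N → Fin (treeSteps N i + 1) → Bool) :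
    treeLaw M N (i + 1) x (joinBlocks b w) =
      if M.obs x = b then ∏ j, branchLaw M N i x (w j) else 0 := by
  have hB : ∀ w : Fin (treeSteps N i + 1) → Bool, branchLaw M N i x w =
      ∑ h : Fin (treeSteps N i + 1) → Ω, if ∀ e, M.obs (h e) = w e then
        M.P x (h 0) * treeProb M N i (extendTraj (treeSteps N i) h) else 0 := by
    intro w
    unfold branchLaw treeLaw obsSeqProb
    simp only [trajProb_treeStrategy, mul_sum]
    rw [sum_comm]
    refine sum_congr rfl fun h _ => ?_
    rw [sum_eq_single (h 0)]
    · simp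
    · intro y _ hy
      rw [if_neg fun h' => hy h'.1.symm, mul_zero]
    · simp
  unfold treeLaw obsSeqProb
  simp only [trajProb_treeStrategy]
  change ∑ f : Fin (N * (treeSteps N i + 1) + 1) → Ω, _ = _
  rw [sum_joinBlocks, sum_eq_single x]
  · have hz : ∀ h : Fin N → Fin (treeSteps N i + 1) → Ω,
        (joinBlocks x h 0 = x ∧ ∀ k, M.obs (joinBlocks x h k) = joinBlocks b w k) ↔
          M.obs x = b ∧ ∀ j e, M.obs (h j e) = w j e := by
      intro h
      rw [forall_joinBlocks]
      simp only [joinBlocks_zero, joinBlocks_apply, true_and]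
    have hP : ∀ h : Fin N → Fin (treeSteps N i + 1) → Ω,
        treeProb M N (i + 1) (extendTraj (treeSteps N (i + 1)) (joinBlocks x h)) =
          ∏ j, (M.P x (h j 0) * treeProb M N i (extendTraj (treeSteps N i) (h j))) := by
      intro h
      have key : ∀ (j : Fin N) (m : ℕ) (hm : m < treeSteps N i + 1),
          extendTraj (treeSteps N (i + 1)) (joinBlocks x h)
            (1 + j * (treeSteps N i + 1) + m) = h j ⟨m, hm⟩ := by
        intro j m hm
        rw [← joinBlocks_apply x h j ⟨m, hm⟩]
        unfold extendTraj
        congr 1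
        apply Fin.ext
        have hlt := (finProdFinEquiv (j, (⟨m, hm⟩ : Fin (treeSteps N i + 1)))).isLt
        simp only [finProdFinEquiv_apply_val, Fin.val_succ] at hlt ⊢
        rw [treeSteps, mul_comm (j : ℕ), min_eq_left (by omega)]
        omega
      rw [treeProb_succ]
      refine prod_congr rfl fun j _ => ?_
      congr 1
      · rw [show extendTraj (treeSteps N (i + 1)) (joinBlocks x h) 0 = x by
          simp [extendTraj]; rfl]
        congr 1
        exact key j 0 (Nat.succ_pos _)
      · refine treeProb_congr M N i fun m hm => ?_
        rw [key j m (Nat.lt_succ_of_le hm)]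
        unfold extendTraj
        congr 1
        apply Fin.ext
        simp [hm]
    simp only [hB]
    rw [prod_univ_sum, Fintype.piFinset_univ]
    by_cases hb : M.obs x = b
    · rw [if_pos hb]
      refine sum_congr rfl fun h _ => ?_
      refine (if_congr (hz h) (hP h) rfl).trans ?_
      rw [Fintype.prod_ite_zero]
      simp [hb]
    · rw [if_neg hb]
      exact sum_eq_zero fun h _ => if_neg fun h' => hb ((hz h).1 h').1
  · intro y _ hy
    exact sum_eq_zero fun h _ => if_neg fun h' => hy h'.1
  · simp

lemma sum_prod_filter_lt_le {W : Type*} [Fintype W] {R v : W → ℝ} {N : ℕ} {ε : ℝ}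
    (hR : ∀ w, 0 ≤ R w) (hR1 : ∑ w, R w = 1) (hv : ∀ w, |v w| ≤ 1)
    (hv0 : ∑ w, R w * v w = 0) (hε : 0 ≤ ε) (hε1 : ε ≤ 1) :
    ∑ w : Fin N → W, (∏ j, R (w j)) * (if N * ε < ∑ j, v (w j) then 1 else 0) ≤
      Real.exp (-(N * ε ^ 2 / 4)) := by
  have h1 : ∀ w : W, Real.exp (ε / 2 * v w) ≤ 1 + ε / 2 * v w + (ε / 2) ^ 2 := by
    intro w
    have hb : |ε / 2 * v w| ≤ 1 := by
      rw [abs_mul, abs_of_nonneg (by linarith)]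
      nlinarith [hv w, abs_nonneg (v w)]
    have h2 := (abs_le.1 (Real.abs_exp_sub_one_sub_id_le hb)).2
    have h3 : v w ^ 2 ≤ 1 := by
      rw [← sq_abs]
      nlinarith [hv w, abs_nonneg (v w)]
    nlinarith [sq_nonneg (ε / 2)]
  have h2 : ∑ w, R w * Real.exp (ε / 2 * v w) ≤ Real.exp ((ε / 2) ^ 2) := by
    calc ∑ w, R w * Real.exp (ε / 2 * v w)
        ≤ ∑ w, (R w * (1 + (ε / 2) ^ 2) + (ε / 2) * (R w * v w)) :=
          sum_le_sum fun w _ => by nlinarith [mul_le_mul_of_nonneg_left (h1 w) (hR w)]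
      _ = 1 + (ε / 2) ^ 2 := by
          rw [sum_add_distrib, ← sum_mul, ← mul_sum, hR1, hv0]; ring
      _ ≤ Real.exp ((ε / 2) ^ 2) := by linarith [Real.add_one_le_exp ((ε / 2) ^ 2)]
  calc ∑ w : Fin N → W, (∏ j, R (w j)) * (if N * ε < ∑ j, v (w j) then 1 else 0)
      ≤ ∑ w : Fin N → W, Real.exp (-(N * ε ^ 2 / 2)) *
          ∏ j, (R (w j) * Real.exp (ε / 2 * v (w j))) := by
        refine sum_le_sum fun w _ => ?_
        rw [prod_mul_distrib, mul_left_comm]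
        refine mul_le_mul_of_nonneg_left ?_ (prod_nonneg fun j _ => hR _)
        rw [← Real.exp_sum, ← mul_sum, ← Real.exp_add]
        split_ifs with h
        · apply Real.one_le_exp
          nlinarith
        · positivity
    _ = Real.exp (-(N * ε ^ 2 / 2)) * (∑ w, R w * Real.exp (ε / 2 * v w)) ^ N := by
        rw [← mul_sum, Fintype.sum_pow]
    _ ≤ Real.exp (-(N * ε ^ 2 / 2)) * Real.exp ((ε / 2) ^ 2) ^ N := by
        refine mul_le_mul_of_nonneg_left (pow_le_pow_left₀ ?_ h2 _) (Real.exp_pos _).le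
        exact sum_nonneg fun w _ => mul_nonneg (hR w) (Real.exp_pos _).le
    _ = Real.exp (-(N * ε ^ 2 / 4)) := by
        rw [← Real.exp_nat_mul, ← Real.exp_add]
        congr 1
        ring

/-- A Hoeffding bound for the empirical mean of `u` over `N` independent samples from `R`. -/
lemma sum_prod_filter_abs_le {W : Type*} [Fintype W] {R u : W → ℝ} {N : ℕ} {ε : ℝ}
    (hR : ∀ w, 0 ≤ R w) (hR1 : ∑ w, R w = 1) (hu : ∀ w, 0 ≤ u w ∧ u w ≤ 1)
    (hε : 0 ≤ ε) (hε1 : ε ≤ 1) (hN : 0 < N) :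
    ∑ w : Fin N → W, (∏ j, R (w j)) *
        (if ε < |(∑ j, u (w j)) / N - ∑ w, R w * u w| then 1 else 0) ≤
      2 * Real.exp (-(N * ε ^ 2 / 4)) := by
  set μ := ∑ w, R w * u w with hμ
  have hμ0 : 0 ≤ μ := sum_nonneg fun w _ => mul_nonneg (hR w) (hu w).1
  have hμ1 : μ ≤ 1 := by
    rw [← hR1]
    exact sum_le_sum fun w _ => mul_le_of_le_one_right (hR w) (hu w).2
  have hN' : (0 : ℝ) < N := Nat.cast_pos.2 hN
  have hs : ∀ s : ℝ, |s| = 1 → ∑ w : Fin N → W, (∏ j, R (w j)) *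
      (if N * ε < ∑ j, s * (u (w j) - μ) then 1 else 0) ≤ Real.exp (-(N * ε ^ 2 / 4)) := by
    intro s hs
    refine sum_prod_filter_lt_le (v := fun w => s * (u w - μ)) hR hR1 (fun w => ?_) ?_ hε hε1
    · rw [abs_mul, hs, one_mul, abs_le]
      constructor <;> linarith [(hu w).1, (hu w).2]
    · calc ∑ w, R w * (s * (u w - μ)) = s * (∑ w, R w * u w - (∑ w, R w) * μ) := by
            rw [sum_mul, ← sum_sub_distrib, mul_sum]
            exact sum_congr rfl fun w _ => by ring
        _ = 0 := by rw [hR1, ← hμ]; ring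
  rw [two_mul]
  refine le_trans ?_ (add_le_add (hs 1 (by simp)) (hs (-1) (by simp)))
  rw [← sum_add_distrib]
  refine sum_le_sum fun w _ => ?_
  rw [← mul_add]
  refine mul_le_mul_of_nonneg_left ?_ (prod_nonneg fun j _ => hR _)
  have h1 : ∀ s : ℝ, ∑ j, s * (u (w j) - μ) = s * (N * ((∑ j, u (w j)) / N - μ)) := by
    intro s
    rw [← mul_sum, sum_sub_distrib]
    simp
    left
    field_simp
  rw [h1, h1]
  set d := (∑ j, u (w j)) / N - μ
  by_cases hd : ε < |d|
  · rw [if_pos hd]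
    rcases lt_abs.1 hd with h | h
    · rw [if_pos (by nlinarith)]
      split_ifs <;> norm_num
    · rw [if_pos (c := _ < -1 * _) (by nlinarith)]
      split_ifs <;> norm_num
  · rw [if_neg hd]
    split_ifs <;> norm_num

/-- Probability of moving from `u` into the class of states that `κ` sends to `c`. -/
noncomputable def classProb (M : Canonical Ω) (κ : Ω → Ω) (u c : Ω) : ℝ :=
  ∑ y, if κ y = c then M.P u y else 0

lemma classProb_nonneg (M : Canonical Ω) (κ : Ω → Ω) (u c : Ω) : 0 ≤ classProb M κ u c :=
  sum_nonneg fun y _ => by split_ifs; exacts [M.nonneg _ _, le_rfl]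

lemma sum_classProb (M : Canonical Ω) (κ : Ω → Ω) (u : Ω) : ∑ c, classProb M κ u c = 1 := by
  unfold classProb
  rw [sum_comm, ← M.sum_one u]
  exact sum_congr rfl fun y _ => by simp

lemma obsHist_congr (M : Canonical Ω) {g g' : ℕ → Ω} {t : ℕ}
    (h : ∀ m ≤ t, M.obs (g m) = M.obs (g' m)) : obsHist M g t = obsHist M g' t := by
  unfold obsHist
  refine List.map_congr_left fun m hm => h m ?_
  have := List.mem_range.1 hm
  omega

lemma extendTraj_snoc {α : Type} {T m : ℕ} (f : Fin (T + 1) → α) (y : α) (hm : m ≤ T) :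
    extendTraj (T + 1) (Fin.snoc f y : Fin (T + 2) → α) m = extendTraj T f m := by
  have h : (⟨min m (T + 1), Nat.lt_succ_of_le (min_le_right m (T + 1))⟩ : Fin (T + 2)) =
      Fin.castSucc ⟨min m T, Nat.lt_succ_of_le (min_le_right m T)⟩ := by
    apply Fin.ext
    simp only [Fin.val_castSucc]
    omega
  unfold extendTraj
  rw [h, Fin.snoc_castSucc (α := fun _ => α)]

lemma extendTraj_snoc_last {α : Type} {T : ℕ} (f : Fin (T + 1) → α) (y : α) :
    extendTraj (T + 1) (Fin.snoc f y : Fin (T + 2) → α) (T + 1) = y := by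
  have h : (⟨min (T + 1) (T + 1), Nat.lt_succ_of_le (min_le_right (T + 1) (T + 1))⟩ :
      Fin (T + 2)) = Fin.last (T + 1) := by
    apply Fin.ext
    simp
  unfold extendTraj
  rw [h, Fin.snoc_last (α := fun _ => α)]

/-- Product over the first `T` steps of a transition weight `q` evaluated along `g`, when the
strategy `A` chooses the source states. -/
noncomputable def pathWeight (M : Canonical Ω) (A : List Bool → ℕ) (q : Ω → Ω → ℝ) (T : ℕ)
    (g : ℕ → Ω) : ℝ :=
  ∏ t ∈ range T, q (g (t - A (obsHist M g t))) (g (t + 1))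

lemma pathWeight_snoc (M : Canonical Ω) (A : List Bool → ℕ) (q : Ω → Ω → ℝ) (T : ℕ)
    (f : Fin (T + 1) → Ω) (y : Ω) :
    pathWeight M A q (T + 1) (extendTraj (T + 1) (Fin.snoc f y : Fin (T + 2) → Ω)) =
      pathWeight M A q T (extendTraj T f) *
        q (extendTraj T f (T - A (obsHist M (extendTraj T f) T))) y := by
  have h : ∀ t ≤ T, obsHist M (extendTraj (T + 1) (Fin.snoc f y : Fin (T + 2) → Ω)) t =
      obsHist M (extendTraj T f) t := fun t ht =>
    obsHist_congr M fun m hm => by rw [extendTraj_snoc f y (hm.trans ht)]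
  unfold pathWeight
  rw [prod_range_succ, extendTraj_snoc_last, h T le_rfl, extendTraj_snoc f y (Nat.sub_le _ _)]
  congr 1
  refine prod_congr rfl fun t ht => ?_
  have ht := mem_range.1 ht
  rw [h t ht.le, extendTraj_snoc f y ((Nat.sub_le _ _).trans ht.le), extendTraj_snoc f y ht]

lemma pathWeight_nonneg (M : Canonical Ω) (A : List Bool → ℕ) {q : Ω → Ω → ℝ}
    (hq : ∀ u v, 0 ≤ q u v) (T : ℕ) (g : ℕ → Ω) : 0 ≤ pathWeight M A q T g :=
  prod_nonneg fun _ _ => hq _ _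

lemma sum_snoc {α : Type} [Fintype α] {T : ℕ} (F : (Fin (T + 2) → α) → ℝ) :
    ∑ f, F f = ∑ f : Fin (T + 1) → α, ∑ y, F (Fin.snoc f y : Fin (T + 2) → α) := by
  rw [← (Fin.snocEquiv fun _ : Fin (T + 2) => α).sum_comp, Fintype.sum_prod_type, sum_comm]
  rfl

lemma sum_pathWeight (M : Canonical Ω) (A : List Bool → ℕ) {q : Ω → Ω → ℝ}
    (hq : ∀ u, ∑ v, q u v = 1) (x : Ω) (T : ℕ) :
    ∑ f : Fin (T + 1) → Ω, (if f 0 = x then pathWeight M A q T (extendTraj T f) else 0) = 1 := by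
  induction T with
  | zero =>
    rw [sum_eq_single fun _ => x]
    · simp [pathWeight]
    · intro f _ hf
      refine if_neg fun h => hf (funext fun i => ?_)
      rw [Subsingleton.elim (α := Fin 1) i 0]
      exact h
    · simp
  | succ T ih =>
    rw [sum_snoc, ← ih]
    refine sum_congr rfl fun f _ => ?_
    have h0 : ∀ y, (Fin.snoc f y : Fin (T + 2) → Ω) 0 = f 0 := fun y =>
      Fin.snoc_castSucc (α := fun _ => Ω) y f 0
    simp only [h0, pathWeight_snoc]
    split_ifs
    · rw [← mul_sum, hq, mul_one]
    · simp

/-- Probability that the chain started at `x` produces the sequence of classes `k`. -/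
noncomputable def classSeqProb (M : Canonical Ω) (A : List Bool → ℕ) (κ : Ω → Ω) (x : Ω) (T : ℕ)
    (k : Fin (T + 1) → Ω) : ℝ :=
  ∑ f : Fin (T + 1) → Ω,
    if f 0 = x ∧ (∀ i, κ (f i) = k i) then pathWeight M A M.P T (extendTraj T f) else 0

/-- Probability of the sequence `k` of class representatives under the chain on classes. -/
noncomputable def lumpedProb (M : Canonical Ω) (A : List Bool → ℕ) (κ : Ω → Ω) (x : Ω) (T : ℕ)
    (k : Fin (T + 1) → Ω) : ℝ :=
  if k 0 = κ x then pathWeight M A (classProb M κ) T (extendTraj T k) else 0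

lemma sum_abs_classSeqProb_sub_lumpedProb_le (M : Canonical Ω) (A : List Bool → ℕ) {κ : Ω → Ω}
    {ε : ℝ} (hobs : ∀ u, M.obs (κ u) = M.obs u)
    (hε : ∀ u, ∑ c, |classProb M κ u c - classProb M κ (κ u) c| ≤ ε) (x : Ω) (T : ℕ) :
    ∑ k, |classSeqProb M A κ x T k - lumpedProb M A κ x T k| ≤ T * ε := by
  induction T with
  | zero =>
    rw [Nat.cast_zero, zero_mul]
    refine le_of_eq (sum_eq_zero fun k _ => ?_)
    rw [abs_eq_zero, sub_eq_zero]
    unfold classSeqProb lumpedProb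
    rw [sum_eq_single fun _ => x]
    · simp only [pathWeight, range_zero, prod_empty, true_and]
      by_cases h : k 0 = κ x
      · rw [if_pos h, if_pos fun i => ?_]
        rw [Subsingleton.elim (α := Fin 1) i 0]
        exact h.symm
      · rw [if_neg h, if_neg fun h' => h (h' 0).symm]
    · intro f _ hf
      refine if_neg fun h => hf (funext fun i => ?_)
      rw [Subsingleton.elim (α := Fin 1) i 0]
      exact h.1
    · simp
  | succ T ih =>
    set W : (Fin (T + 1) → Ω) → ℝ := fun f => pathWeight M A M.P T (extendTraj T f)
    set par : (Fin (T + 1) → Ω) → Ω := fun f =>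
      extendTraj T f (T - A (obsHist M (extendTraj T f) T))
    have hW : ∀ f, 0 ≤ W f := fun f => pathWeight_nonneg M A M.nonneg T _
    have hsnoc0 : ∀ (f : Fin (T + 1) → Ω) y, (Fin.snoc f y : Fin (T + 2) → Ω) 0 = f 0 :=
      fun f y => Fin.snoc_castSucc (α := fun _ => Ω) y f 0
    have hpar : ∀ f k : Fin (T + 1) → Ω, (∀ i, κ (f i) = k i) → κ (par f) = par k := by
      intro f k h
      have hh : obsHist M (extendTraj T f) T = obsHist M (extendTraj T k) T :=
        obsHist_congr M fun m _ => by
          unfold extendTraj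
          rw [← h, hobs]
      simp only [par]
      rw [hh]
      exact h _
    have hstep : ∀ (k : Fin (T + 1) → Ω) (c : Ω),
        classSeqProb M A κ x (T + 1) (Fin.snoc k c : Fin (T + 2) → Ω) =
          ∑ f, if f 0 = x ∧ (∀ i, κ (f i) = k i) then W f * classProb M κ (par f) c else 0 := by
      intro k c
      unfold classSeqProb
      rw [sum_snoc]
      refine sum_congr rfl fun f _ => ?_
      have hiff : ∀ y, ((Fin.snoc f y : Fin (T + 2) → Ω) 0 = x ∧
          ∀ i, κ ((Fin.snoc f y : Fin (T + 2) → Ω) i) = (Fin.snoc k c : Fin (T + 2) → Ω) i) ↔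
          (f 0 = x ∧ ∀ i, κ (f i) = k i) ∧ κ y = c := by
        intro y
        rw [hsnoc0, Fin.forall_fin_succ']
        simp only [Fin.snoc_castSucc (α := fun _ => Ω), Fin.snoc_last (α := fun _ => Ω)]
        tauto
      simp only [hiff, pathWeight_snoc]
      by_cases h : f 0 = x ∧ ∀ i, κ (f i) = k i
      · rw [if_pos h]
        unfold classProb
        rw [mul_sum]
        refine sum_congr rfl fun y _ => ?_
        by_cases hy : κ y = c
        · rw [if_pos ⟨h, hy⟩, if_pos hy]
        · rw [if_neg fun h' => hy h'.2, if_neg hy, mul_zero]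
      · rw [if_neg h]
        exact sum_eq_zero fun y _ => if_neg fun h' => h h'.1
    have hlump : ∀ (k : Fin (T + 1) → Ω) (c : Ω),
        lumpedProb M A κ x (T + 1) (Fin.snoc k c : Fin (T + 2) → Ω) =
          lumpedProb M A κ x T k * classProb M κ (par k) c := by
      intro k c
      unfold lumpedProb
      rw [hsnoc0, pathWeight_snoc]
      split_ifs <;> simp [par]
    have hbound : ∀ (k : Fin (T + 1) → Ω),
        ∑ c, |classSeqProb M A κ x (T + 1) (Fin.snoc k c : Fin (T + 2) → Ω) -
          lumpedProb M A κ x (T + 1) (Fin.snoc k c : Fin (T + 2) → Ω)| ≤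
        (∑ f, if f 0 = x ∧ (∀ i, κ (f i) = k i) then W f * ε else 0) +
          |classSeqProb M A κ x T k - lumpedProb M A κ x T k| := by
      intro k
      calc _ ≤ ∑ c, ((∑ f, if f 0 = x ∧ (∀ i, κ (f i) = k i) then
              W f * |classProb M κ (par f) c - classProb M κ (κ (par f)) c| else 0) +
            |classSeqProb M A κ x T k - lumpedProb M A κ x T k| * classProb M κ (par k) c) := by
            refine sum_le_sum fun c _ => ?_
            have hsplit : classSeqProb M A κ x (T + 1) (Fin.snoc k c : Fin (T + 2) → Ω) -
                lumpedProb M A κ x (T + 1) (Fin.snoc k c : Fin (T + 2) → Ω) =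
                (∑ f, if f 0 = x ∧ (∀ i, κ (f i) = k i) then
                  W f * (classProb M κ (par f) c - classProb M κ (κ (par f)) c) else 0) +
                (classSeqProb M A κ x T k - lumpedProb M A κ x T k) *
                  classProb M κ (par k) c := by
              rw [hstep, hlump, sub_mul, ← add_sub_assoc]
              congr 1
              unfold classSeqProb
              rw [sum_mul, ← sum_add_distrib]
              refine sum_congr rfl fun f _ => ?_
              split_ifs with h
              · rw [hpar f k h.2]
                ring
              · simp
            rw [hsplit]
            refine (abs_add_le _ _).trans (add_le_add ?_ ?_)
            · refine (abs_sum_le_sum_abs _ _).trans (sum_le_sum fun f _ => ?_)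
              split_ifs
              · rw [abs_mul, abs_of_nonneg (hW f)]
              · simp
            · rw [abs_mul, abs_of_nonneg (classProb_nonneg M κ _ _)]
        _ ≤ _ := by
            rw [sum_add_distrib, ← mul_sum, sum_classProb, mul_one, sum_comm]
            refine add_le_add (sum_le_sum fun f _ => ?_) le_rfl
            split_ifs
            · rw [← mul_sum]
              exact mul_le_mul_of_nonneg_left (hε _) (hW f)
            · simp
    rw [sum_snoc]
    refine (sum_le_sum fun k _ => hbound k).trans ?_
    rw [sum_add_distrib]
    have hmass : ∑ k : Fin (T + 1) → Ω, ∑ f : Fin (T + 1) → Ω,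
        (if f 0 = x ∧ (∀ i, κ (f i) = k i) then W f * ε else 0) = ε := by
      rw [sum_comm]
      calc _ = ∑ f : Fin (T + 1) → Ω, (if f 0 = x then W f else 0) * ε := by
            refine sum_congr rfl fun f _ => ?_
            rw [sum_eq_single fun i => κ (f i)]
            · simp
            · intro k _ hk
              exact if_neg fun h => hk (funext fun i => (h.2 i).symm)
            · simp
        _ = ε := by rw [← sum_mul, sum_pathWeight M A M.sum_one x T, one_mul]
    rw [hmass]
    push_cast
    linarith

lemma obsTV_le_of_classes (M : Canonical Ω) (A : List Bool → ℕ) {κ : Ω → Ω}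
    {ε : ℝ} (hobs : ∀ u, M.obs (κ u) = M.obs u)
    (hε : ∀ u, ∑ c, |classProb M κ u c - classProb M κ (κ u) c| ≤ ε) {a b : Ω}
    (hab : κ a = κ b) (T : ℕ) : obsTV M A a b T ≤ T * ε := by
  have hsum : ∀ (x : Ω) (z : Fin (T + 1) → Bool), obsSeqProb M A x T z =
      ∑ k : Fin (T + 1) → Ω,
        if ∀ i, M.obs (k i) = z i then classSeqProb M A κ x T k else 0 := by
    intro x z
    calc obsSeqProb M A x T z = ∑ f : Fin (T + 1) → Ω, ∑ k : Fin (T + 1) → Ω,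
          if (∀ i, M.obs (k i) = z i) ∧ f 0 = x ∧ ∀ i, κ (f i) = k i then
            pathWeight M A M.P T (extendTraj T f) else 0 := by
          refine sum_congr rfl fun f _ => ?_
          rw [sum_eq_single fun i => κ (f i)]
          · simp only [hobs, implies_true, and_true]
            simp only [and_comm]
            rfl
          · intro k _ hk
            exact if_neg fun h => hk (funext fun i => (h.2.2 i).symm)
          · simp
      _ = _ := by
          rw [sum_comm]
          refine sum_congr rfl fun k _ => ?_
          unfold classSeqProb
          split_ifs with h
          · simp only [h, implies_true, true_and]
          · simp [h]
  have h1 : ∀ z, |obsSeqProb M A a T z - obsSeqProb M A b T z| ≤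
      ∑ k : Fin (T + 1) → Ω, if ∀ i, M.obs (k i) = z i then
        |classSeqProb M A κ a T k - classSeqProb M A κ b T k| else 0 := by
    intro z
    rw [hsum, hsum, ← sum_sub_distrib]
    refine (abs_sum_le_sum_abs _ _).trans (sum_le_sum fun k _ => ?_)
    split_ifs <;> simp
  have h2 : ∑ z : Fin (T + 1) → Bool, |obsSeqProb M A a T z - obsSeqProb M A b T z| ≤
      ∑ k : Fin (T + 1) → Ω, |classSeqProb M A κ a T k - classSeqProb M A κ b T k| := by
    refine (sum_le_sum fun z _ => h1 z).trans (le_of_eq ?_)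
    rw [sum_comm]
    refine sum_congr rfl fun k _ => ?_
    rw [sum_eq_single fun i => M.obs (k i)]
    · simp
    · intro z _ hz
      exact if_neg fun h => hz (funext fun i => (h i).symm)
    · simp
  have h3 : ∑ k : Fin (T + 1) → Ω, |classSeqProb M A κ a T k - classSeqProb M A κ b T k| ≤
      ∑ k : Fin (T + 1) → Ω, |classSeqProb M A κ a T k - lumpedProb M A κ a T k| +
      ∑ k : Fin (T + 1) → Ω, |classSeqProb M A κ b T k - lumpedProb M A κ b T k| := by
    rw [← sum_add_distrib]
    refine sum_le_sum fun k _ => ?_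
    have hk : lumpedProb M A κ a T k = lumpedProb M A κ b T k := by
      unfold lumpedProb
      rw [hab]
    rw [hk, abs_sub_comm (classSeqProb M A κ b T k)]
    exact abs_sub_le _ _ _
  have ha := sum_abs_classSeqProb_sub_lumpedProb_le M A hobs hε a T
  have hb := sum_abs_classSeqProb_sub_lumpedProb_le M A hobs hε b T
  unfold obsTV
  linarith

/-- The `ℓ¹` distance between the next-class distributions of `u` and `v`. -/
noncomputable def classDist (M : Canonical Ω) (κ : Ω → Ω) (u v : Ω) : ℝ :=
  ∑ c, |classProb M κ u c - classProb M κ v c|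

lemma classDist_comm (M : Canonical Ω) (κ : Ω → Ω) (u v : Ω) :
    classDist M κ u v = classDist M κ v u :=
  sum_congr rfl fun _ _ => abs_sub_comm _ _

lemma classDist_triangle (M : Canonical Ω) (κ : Ω → Ω) (u v w : Ω) :
    classDist M κ u w ≤ classDist M κ u v + classDist M κ v w := by
  unfold classDist
  rw [← sum_add_distrib]
  exact sum_le_sum fun _ _ => abs_sub_le _ _ _

/-- The graph joining states with equal observation and `η`-close next-class distributions. -/
def closeGraph (M : Canonical Ω) (η : ℝ) (κ : Ω → Ω) : SimpleGraph Ω where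
  Adj u v := u ≠ v ∧ M.obs u = M.obs v ∧ classDist M κ u v ≤ η
  symm := ⟨fun u v h => ⟨h.1.symm, h.2.1.symm, classDist_comm M κ u v ▸ h.2.2⟩⟩
  loopless := ⟨fun _ h => h.1 rfl⟩

/-- Representative of the connected component of a state in `closeGraph`. -/
noncomputable def refineClass (M : Canonical Ω) (η : ℝ) (κ : Ω → Ω) (u : Ω) : Ω :=
  Quot.out ((closeGraph M η κ).connectedComponentMk u)

lemma reachable_refineClass (M : Canonical Ω) (η : ℝ) (κ : Ω → Ω) (u : Ω) :
    (closeGraph M η κ).Reachable (refineClass M η κ u) u :=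
  SimpleGraph.ConnectedComponent.exact (Quot.out_eq _)

lemma refineClass_eq_iff (M : Canonical Ω) (η : ℝ) (κ : Ω → Ω) (u v : Ω) :
    refineClass M η κ u = refineClass M η κ v ↔ (closeGraph M η κ).Reachable u v := by
  constructor
  · intro h
    exact (reachable_refineClass M η κ u).symm.trans (h ▸ reachable_refineClass M η κ v)
  · intro h
    unfold refineClass
    rw [SimpleGraph.ConnectedComponent.sound h]

lemma refineClass_eq_of_classDist_le (M : Canonical Ω) {η : ℝ} {κ : Ω → Ω} {u v : Ω}
    (ho : M.obs u = M.obs v) (hd : classDist M κ u v ≤ η) :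
    refineClass M η κ u = refineClass M η κ v := by
  rw [refineClass_eq_iff]
  by_cases h : u = v
  · exact h ▸ SimpleGraph.Reachable.refl u
  · exact SimpleGraph.Adj.reachable ⟨h, ho, hd⟩

lemma obs_eq_and_classDist_le_of_walk (M : Canonical Ω) {η : ℝ} {κ : Ω → Ω} {u v : Ω}
    (p : (closeGraph M η κ).Walk u v) :
    M.obs u = M.obs v ∧ classDist M κ u v ≤ p.length * η := by
  induction p with
  | nil => simp [classDist]
  | @cons u v w h p ih =>
    refine ⟨h.2.1.trans ih.1, (classDist_triangle M κ u v w).trans ?_⟩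
    rw [SimpleGraph.Walk.length_cons]
    push_cast
    linarith [h.2.2, ih.2]

lemma obs_eq_and_classDist_le_of_reachable (M : Canonical Ω) {η : ℝ} (hη : 0 ≤ η) {κ : Ω → Ω}
    {u v : Ω} (h : (closeGraph M η κ).Reachable u v) :
    M.obs u = M.obs v ∧ classDist M κ u v ≤ Fintype.card Ω * η := by
  obtain ⟨p, hp⟩ := h.exists_isPath
  have h1 := obs_eq_and_classDist_le_of_walk M p
  refine ⟨h1.1, h1.2.trans (mul_le_mul_of_nonneg_right ?_ hη)⟩
  exact_mod_cast hp.length_lt.le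

lemma classProb_eq_sum_of_comp_eq (M : Canonical Ω) {κ κ' : Ω → Ω}
    (h : ∀ y, κ (κ' y) = κ y) (u c : Ω) :
    classProb M κ u c = ∑ d, if κ d = c then classProb M κ' u d else 0 := by
  calc classProb M κ u c = ∑ y, ∑ d, if κ d = c then if κ' y = d then M.P u y else 0 else 0 := by
        refine sum_congr rfl fun y _ => ?_
        rw [sum_eq_single (κ' y)]
        · simp [h]
        · intro d _ hd
          simp [hd.symm]
        · simp
    _ = _ := by
        rw [sum_comm]
        refine sum_congr rfl fun d _ => ?_
        unfold classProb
        split_ifs <;> simp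

lemma classDist_le_of_comp_eq (M : Canonical Ω) {κ κ' : Ω → Ω}
    (h : ∀ y, κ (κ' y) = κ y) (u v : Ω) : classDist M κ u v ≤ classDist M κ' u v := by
  unfold classDist
  simp only [classProb_eq_sum_of_comp_eq M h, ← sum_sub_distrib]
  calc _ ≤ ∑ c, ∑ d, if κ d = c then |classProb M κ' u d - classProb M κ' v d| else 0 := by
        refine sum_le_sum fun c _ => (abs_sum_le_sum_abs _ _).trans (sum_le_sum fun d _ => ?_)
        split_ifs <;> simp
    _ = _ := by
        rw [sum_comm]
        exact sum_congr rfl fun d _ => by simp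

lemma refineClass_comp_eq (M : Canonical Ω) (η : ℝ) {κ κ' : Ω → Ω}
    (h : ∀ y, κ (κ' y) = κ y) (u : Ω) :
    refineClass M η κ (refineClass M η κ' u) = refineClass M η κ u := by
  rw [refineClass_eq_iff]
  refine (reachable_refineClass M η κ' u).mono fun v w hvw => ?_
  exact ⟨hvw.1, hvw.2.1, (classDist_le_of_comp_eq M h v w).trans hvw.2.2⟩

/-- Successive refinements of the partition of the states by observation. -/
noncomputable def classRep (M : Canonical Ω) (η : ℝ) : ℕ → Ω → Ω
  | 0 => refineClass M η fun _ => M.sink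
  | i + 1 => refineClass M η (classRep M η i)

lemma classRep_comp_succ (M : Canonical Ω) (η : ℝ) (i : ℕ) (u : Ω) :
    classRep M η i (classRep M η (i + 1) u) = classRep M η i u := by
  induction i generalizing u with
  | zero => exact refineClass_comp_eq M η (κ := fun _ => M.sink) (fun _ => rfl) u
  | succ i ih => exact refineClass_comp_eq M η ih u

lemma classRep_eq_of_le (M : Canonical Ω) (η : ℝ) {i m : ℕ} (him : i ≤ m) {u v : Ω}
    (h : classRep M η m u = classRep M η m v) : classRep M η i u = classRep M η i v := by
  induction m, him using Nat.le_induction with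
  | base => exact h
  | succ m _ ih =>
    apply ih
    rw [← classRep_comp_succ, h, classRep_comp_succ]

lemma obs_classRep (M : Canonical Ω) {η : ℝ} (hη : 0 ≤ η) (i : ℕ) (u : Ω) :
    M.obs (classRep M η i u) = M.obs u := by
  cases i with
  | zero => exact (obs_eq_and_classDist_le_of_reachable M hη (reachable_refineClass M η _ u)).1
  | succ i => exact (obs_eq_and_classDist_le_of_reachable M hη (reachable_refineClass M η _ u)).1

lemma classRep_zero_eq (M : Canonical Ω) {η : ℝ} (hη : 0 ≤ η) {u v : Ω}
    (h : M.obs u = M.obs v) : classRep M η 0 u = classRep M η 0 v :=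
  refineClass_eq_of_classDist_le M h (by simpa [classDist, classProb, M.sum_one] using hη)

lemma classRep_stable_of_card_le (M : Canonical Ω) {η : ℝ} {i : ℕ}
    (h : (univ.image (classRep M η (i + 1))).card ≤ (univ.image (classRep M η i)).card) {u v : Ω}
    (huv : classRep M η i u = classRep M η i v) :
    classRep M η (i + 1) u = classRep M η (i + 1) v := by
  have himg : univ.image (classRep M η i) =
      (univ.image (classRep M η (i + 1))).image (classRep M η i) := by
    rw [image_image]
    exact image_congr fun y _ => (classRep_comp_succ M η i y).symm
  rw [himg] at h
  have hinj := injOn_of_card_image_eq (le_antisymm card_image_le h)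
  refine hinj (by simp) (by simp) ?_
  rw [classRep_comp_succ, classRep_comp_succ, huv]

lemma exists_stable_classRep (M : Canonical Ω) {η : ℝ} (hη : 0 ≤ η) {m : ℕ}
    (hm : Fintype.card Ω = m + 2) {a b : Ω} (hab : a ≠ b)
    (h : classRep M η m a = classRep M η m b) :
    ∃ i, classRep M η i a = classRep M η i b ∧ ∀ u v, classRep M η i u = classRep M η i v →
      classRep M η (i + 1) u = classRep M η (i + 1) v := by
  by_contra hcon
  have hgrow : ∀ i < m, (univ.image (classRep M η i)).card <
      (univ.image (classRep M η (i + 1))).card := by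
    intro i hi
    by_contra hle
    exact hcon ⟨i, classRep_eq_of_le M η hi.le h, fun u v huv =>
      classRep_stable_of_card_le M (not_lt.1 hle) huv⟩
  have hcard : ∀ i ≤ m, i + 2 ≤ (univ.image (classRep M η i)).card := by
    intro i
    induction i with
    | zero =>
      intro _
      have : Nontrivial Ω := ⟨⟨a, b, hab⟩⟩
      obtain ⟨y, hy⟩ := exists_ne M.sink
      refine one_lt_card.2 ⟨_, mem_image_of_mem _ (mem_univ y), _,
        mem_image_of_mem _ (mem_univ M.sink), fun hh => ?_⟩
      have h1 := congrArg M.obs hh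
      rw [obs_classRep M hη, obs_classRep M hη] at h1
      simp [Canonical.obs, hy] at h1
    | succ i ih =>
      intro hi
      have := ih (by omega)
      have := hgrow i (by omega)
      omega
  have hc : (univ.image (classRep M η m)).card = (univ : Finset Ω).card :=
    le_antisymm card_image_le (by rw [card_univ, hm]; exact hcard m le_rfl)
  exact hab (injOn_of_card_image_eq hc (by simp) (by simp) h)

lemma classRep_ne_of_obsTV (M : Canonical Ω) {η : ℝ} (hη : 0 ≤ η) {m T : ℕ}
    (hm : Fintype.card Ω = m + 2) {A : List Bool → ℕ} {a b : Ω}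
    (hT : T * ((m + 2 : ℕ) * η) < obsTV M A a b T) :
    classRep M η m a ≠ classRep M η m b := by
  intro h
  have hab : a ≠ b := by
    rintro rfl
    have h0 : obsTV M A a a T = 0 := by simp [obsTV]
    rw [h0] at hT
    exact absurd hT (not_lt.2 (by positivity))
  obtain ⟨i, hi, hst⟩ := exists_stable_classRep M hη hm hab h
  refine absurd hT (not_lt.2 (obsTV_le_of_classes M A (obs_classRep M hη i) (fun u => ?_) hi T))
  have hidem : classRep M η i (classRep M η i u) = classRep M η i u := by
    cases i with
    | zero => exact (refineClass_eq_iff M η _ _ _).2 (reachable_refineClass M η _ u)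
    | succ i => exact (refineClass_eq_iff M η _ _ _).2 (reachable_refineClass M η _ u)
  rw [← hm]
  exact (obs_eq_and_classDist_le_of_reachable M hη
    ((refineClass_eq_iff M η _ _ _).1 (hst _ _ hidem.symm))).2

lemma treeLaw_nonneg (M : Canonical Ω) (N i : ℕ) (x : Ω)
    (z : Fin (treeSteps N i + 1) → Bool) : 0 ≤ treeLaw M N i x z := by
  refine sum_nonneg fun f _ => ?_
  split_ifs
  · exact pathWeight_nonneg M _ M.nonneg _ _
  · exact le_rfl

lemma sum_treeLaw (M : Canonical Ω) (N i : ℕ) (x : Ω) : ∑ z, treeLaw M N i x z = 1 := by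
  unfold treeLaw obsSeqProb
  rw [sum_comm, ← sum_pathWeight M (treeStrategy N i) M.sum_one x (treeSteps N i)]
  refine sum_congr rfl fun f _ => ?_
  rw [sum_eq_single fun k => M.obs (f k)]
  · simp only [implies_true, and_true]
    rfl
  · intro z _ hz
    exact if_neg fun h => hz (funext fun k => (h.2 k).symm)
  · simp

lemma branchLaw_nonneg (M : Canonical Ω) (N i : ℕ) (x : Ω)
    (w : Fin (treeSteps N i + 1) → Bool) : 0 ≤ branchLaw M N i x w :=
  sum_nonneg fun _ _ => mul_nonneg (M.nonneg _ _) (treeLaw_nonneg M N i _ w)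

lemma sum_branchLaw (M : Canonical Ω) (N i : ℕ) (x : Ω) : ∑ w, branchLaw M N i x w = 1 := by
  unfold branchLaw
  rw [sum_comm, ← M.sum_one x]
  exact sum_congr rfl fun y _ => by rw [← mul_sum, sum_treeLaw, mul_one]

lemma abs_sum_branchLaw_sub_classProb_le (M : Canonical Ω) (N i : ℕ) {κ : Ω → Ω} {δ : ℝ}
    {dec : (Fin (treeSteps N i + 1) → Bool) → Ω}
    (hdec : ∀ y, ∑ w, treeLaw M N i y w * (if dec w = κ y then 0 else 1) ≤ δ) (x c : Ω) :
    |∑ w, branchLaw M N i x w * (if dec w = c then 1 else 0) - classProb M κ x c| ≤ δ := by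
  have h : ∑ w, branchLaw M N i x w * (if dec w = c then (1 : ℝ) else 0) - classProb M κ x c =
      ∑ y, M.P x y * ∑ w, treeLaw M N i y w *
        ((if dec w = c then 1 else 0) - if κ y = c then 1 else 0) := by
    unfold branchLaw classProb
    simp only [sum_mul, mul_sub, sum_sub_distrib]
    rw [sum_comm]
    congr 1
    · refine sum_congr rfl fun y _ => ?_
      rw [mul_sum]
      exact sum_congr rfl fun w _ => mul_assoc _ _ _
    · refine sum_congr rfl fun y _ => ?_
      rw [← sum_mul, sum_treeLaw, one_mul, mul_ite, mul_one, mul_zero]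
  rw [h]
  calc _ ≤ ∑ y, M.P x y * δ := by
        refine (abs_sum_le_sum_abs _ _).trans (sum_le_sum fun y _ => ?_)
        rw [abs_mul, abs_of_nonneg (M.nonneg x y)]
        refine mul_le_mul_of_nonneg_left (le_trans ?_ (hdec y)) (M.nonneg x y)
        refine (abs_sum_le_sum_abs _ _).trans (sum_le_sum fun w _ => ?_)
        rw [abs_mul, abs_of_nonneg (treeLaw_nonneg M N i y w)]
        refine mul_le_mul_of_nonneg_left ?_ (treeLaw_nonneg M N i y w)
        by_cases h1 : dec w = κ y
        · simp [h1]
        · rw [if_neg h1]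
          split_ifs <;> norm_num
    _ = δ := by rw [← sum_mul, M.sum_one, one_mul]

lemma exists_classRep_decoder (M : Canonical Ω) {N : ℕ} (hN : 0 < N) {η ε : ℝ} (hε : 0 ≤ ε)
    (hε1 : ε ≤ 1) (hη : 4 * Fintype.card Ω * ε = η)
    (hexp : 2 * Fintype.card Ω * Real.exp (-(N * ε ^ 2 / 4)) ≤ ε) (i : ℕ) :
    ∃ dec : (Fin (treeSteps N i + 1) → Bool) → Ω, ∀ x,
      ∑ z, treeLaw M N i x z * (if dec z = classRep M η i x then 0 else 1) ≤ ε := by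
  classical
  have hη0 : 0 ≤ η := by rw [← hη]; positivity
  induction i with
  | zero =>
    refine ⟨fun z => if h : ∃ u, M.obs u = z 0 then classRep M η 0 h.choose else M.sink,
      fun x => (le_of_eq (sum_eq_zero fun z _ => ?_)).trans hε⟩
    rw [treeLaw_zero]
    by_cases hx : M.obs x = z 0
    · have h : ∃ u, M.obs u = z 0 := ⟨x, hx⟩
      beta_reduce
      rw [dif_pos h, classRep_zero_eq M hη0 (h.choose_spec.trans hx.symm), if_pos rfl, mul_zero]
    · rw [if_neg hx, zero_mul]
  | succ i ih =>
    obtain ⟨dec, hdec⟩ := ih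
    set freq : (Fin N → Fin (treeSteps N i + 1) → Bool) → Ω → ℝ := fun w c =>
      (∑ j, if dec (w j) = c then (1 : ℝ) else 0) / N
    set good : Bool → (Fin N → Fin (treeSteps N i + 1) → Bool) → Ω → Prop := fun o w u =>
      M.obs u = o ∧ ∑ c, |freq w c - classProb M (classRep M η i) u c| ≤ η / 2
    set dec' : Bool → (Fin N → Fin (treeSteps N i + 1) → Bool) → Ω := fun o w =>
      if h : ∃ u, good o w u then classRep M η (i + 1) h.choose else M.sink
    refine ⟨fun z => dec' (z 0) fun j e =>
      (z : Fin (N * (treeSteps N i + 1) + 1) → Bool) (finProdFinEquiv (j, e)).succ, fun x => ?_⟩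
    set μ : Ω → ℝ := fun c =>
      ∑ w, branchLaw M N i x w * (if dec w = c then (1 : ℝ) else 0)
    have hprod : ∀ w : Fin N → Fin (treeSteps N i + 1) → Bool,
        0 ≤ ∏ j, branchLaw M N i x (w j) :=
      fun w => prod_nonneg fun j _ => branchLaw_nonneg M N i x _
    have hgood : ∀ w, (∀ c, |freq w c - μ c| ≤ ε) →
        dec' (M.obs x) w = classRep M η (i + 1) x := by
      intro w hw
      have hx : good (M.obs x) w x := by
        refine ⟨rfl, ?_⟩
        calc _ ≤ ∑ _c : Ω, (ε + ε) := by
              refine sum_le_sum fun c _ => (abs_sub_le _ (μ c) _).trans (add_le_add (hw c) ?_)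
              exact abs_sum_branchLaw_sub_classProb_le M N i hdec x c
          _ = η / 2 := by
              rw [sum_const, card_univ, nsmul_eq_mul, ← hη]
              ring
      have h : ∃ u, good (M.obs x) w u := ⟨x, hx⟩
      have hu := h.choose_spec
      simp only [dec']
      rw [dif_pos h]
      refine refineClass_eq_of_classDist_le M hu.1 ?_
      calc classDist M (classRep M η i) h.choose x
          ≤ ∑ c, (|freq w c - classProb M (classRep M η i) h.choose c| +
              |freq w c - classProb M (classRep M η i) x c|) := by
            refine sum_le_sum fun c _ => ?_
            rw [abs_sub_comm (freq w c)]
            exact abs_sub_le _ _ _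
        _ ≤ η := by
            rw [sum_add_distrib]
            linarith [hu.2, hx.2]
    change ∑ z : Fin (N * (treeSteps N i + 1) + 1) → Bool, _ ≤ _
    rw [sum_joinBlocks, sum_eq_single (M.obs x)]
    · calc _ ≤ ∑ w : Fin N → Fin (treeSteps N i + 1) → Bool, ∑ c,
            (∏ j, branchLaw M N i x (w j)) * (if ε < |freq w c - μ c| then 1 else 0) := by
            refine sum_le_sum fun w _ => ?_
            rw [treeLaw_succ, if_pos rfl, ← mul_sum]
            refine mul_le_mul_of_nonneg_left ?_ (hprod w)
            simp only [joinBlocks_apply]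
            change (if dec' (M.obs x) w = _ then (0 : ℝ) else 1) ≤ _
            have h0 : ∀ c ∈ univ, (0 : ℝ) ≤ if ε < |freq w c - μ c| then 1 else 0 := by
              intro c _
              split_ifs <;> norm_num
            by_cases hw : ∀ c, |freq w c - μ c| ≤ ε
            · rw [if_pos (hgood w hw)]
              exact sum_nonneg h0
            · push Not at hw
              obtain ⟨c, hc⟩ := hw
              refine le_trans ?_ (single_le_sum h0 (mem_univ c))
              rw [if_pos hc]
              split_ifs <;> norm_num
        _ ≤ ∑ _c : Ω, 2 * Real.exp (-(N * ε ^ 2 / 4)) := by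
            rw [sum_comm]
            refine sum_le_sum fun c _ => ?_
            refine sum_prod_filter_abs_le (u := fun w => if dec w = c then 1 else 0)
              (branchLaw_nonneg M N i x) (sum_branchLaw M N i x) (fun w => ?_) hε hε1 hN
            split_ifs <;> norm_num
        _ ≤ ε := by
            rw [sum_const, card_univ, nsmul_eq_mul]
            linarith
    · intro o _ ho
      refine sum_eq_zero fun w _ => ?_
      rw [treeLaw_succ, if_neg (Ne.symm ho), zero_mul]
    · simp

lemma one_sub_two_mul_le_obsTV (M : Canonical Ω) {A : List Bool → ℕ} {a b c d : Ω} {T : ℕ}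
    {δ : ℝ} {dec : (Fin (T + 1) → Bool) → Ω} (hcd : c ≠ d)
    (ha1 : ∑ z, obsSeqProb M A a T z = 1) (hb1 : ∑ z, obsSeqProb M A b T z = 1)
    (hb0 : ∀ z, 0 ≤ obsSeqProb M A b T z)
    (ha : ∑ z, obsSeqProb M A a T z * (if dec z = c then 0 else 1) ≤ δ)
    (hb : ∑ z, obsSeqProb M A b T z * (if dec z = d then 0 else 1) ≤ δ) :
    1 - 2 * δ ≤ obsTV M A a b T := by
  have h1 : ∑ z, (obsSeqProb M A a T z - 2 * (obsSeqProb M A a T z *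
      (if dec z = c then 0 else 1)) + obsSeqProb M A b T z - 2 * (obsSeqProb M A b T z *
      (if dec z = d then 0 else 1))) ≤
      ∑ z, |obsSeqProb M A a T z - obsSeqProb M A b T z| := by
    refine sum_le_sum fun z _ => ?_
    have hz := hb0 z
    have h2 := le_abs_self (obsSeqProb M A a T z - obsSeqProb M A b T z)
    have h3 := neg_le_abs (obsSeqProb M A a T z - obsSeqProb M A b T z)
    by_cases h4 : dec z = c
    · rw [if_pos h4, if_neg (h4.trans_ne hcd)]
      linarith
    · rw [if_neg h4]
      split_ifs <;> linarith
  rw [sum_sub_distrib, sum_add_distrib, sum_sub_distrib, ← mul_sum, ← mul_sum, ha1, hb1] at h1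
  unfold obsTV
  linarith

lemma NAQC_le_treeSteps (M : Canonical Ω) {N i : ℕ} {a b : Ω}
    (h : 1 / 3 ≤ obsTV M (treeStrategy N i) a b (treeSteps N i)) :
    NAQC M a b ≤ (treeSteps N i : ℝ≥0∞) :=
  (iInf_le _ (⟨_, nonAdaptive_treeStrategy N i⟩ : {A : List Bool → ℕ // NonAdaptive A})).trans
    (sInf_le ⟨_, rfl, h⟩)

lemma exists_obsTV_of_AQC_eq (M : Canonical Ω) {a b : Ω} {Q : ℕ} (h : AQC M a b = (Q : ℝ≥0∞)) :
    ∃ A : List Bool → ℕ, ∃ T ≤ Q, 1 / 3 ≤ obsTV M A a b T := by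
  have h1 : AQC M a b < ((Q + 1 : ℕ) : ℝ≥0∞) := by
    rw [h]
    exact_mod_cast Nat.lt_succ_self Q
  obtain ⟨A, hA⟩ := iInf_lt_iff.1 h1
  obtain ⟨_, ⟨T, rfl, hT⟩, hlt⟩ := sInf_lt_iff.1 hA
  exact ⟨A, T, Nat.lt_succ_iff.1 (by exact_mod_cast hlt), hT⟩

lemma NAQC_le_of_exp_le (M : Canonical Ω) {a b : Ω} {Q N m : ℕ} {ε : ℝ}
    (hm : Fintype.card Ω = m + 2) (hAQC : AQC M a b = (Q : ℝ≥0∞)) (hN : 0 < N) (hε : 0 ≤ ε)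
    (hε1 : ε ≤ 1 / 3) (hQ : 16 * (Fintype.card Ω : ℝ) ^ 2 * Q * ε ≤ 1)
    (hexp : 2 * Fintype.card Ω * Real.exp (-(N * ε ^ 2 / 4)) ≤ ε) :
    NAQC M a b ≤ (((N + 1) ^ m : ℕ) : ℝ≥0∞) := by
  obtain ⟨A, T, hTQ, hT⟩ := exists_obsTV_of_AQC_eq M hAQC
  have hη0 : 0 ≤ 4 * (Fintype.card Ω : ℝ) * ε := by positivity
  have hne : classRep M (4 * Fintype.card Ω * ε) m a ≠ classRep M (4 * Fintype.card Ω * ε) m b := by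
    refine classRep_ne_of_obsTV M hη0 hm (lt_of_lt_of_le ?_ hT)
    have hTQ' : (T : ℝ) ≤ Q := Nat.cast_le.2 hTQ
    rw [← hm]
    have := mul_le_mul_of_nonneg_right hTQ'
      (mul_nonneg (Nat.cast_nonneg (Fintype.card Ω)) hη0)
    nlinarith
  obtain ⟨dec, hdec⟩ := exists_classRep_decoder M hN hε (by linarith) rfl hexp m
  have hTV := one_sub_two_mul_le_obsTV M hne (sum_treeLaw M N m a) (sum_treeLaw M N m b)
    (treeLaw_nonneg M N m b) (hdec a) (hdec b)
  refine (NAQC_le_treeSteps M (N := N) (i := m) (by linarith)).trans ?_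
  exact_mod_cast (Nat.le_succ _).trans (treeSteps_add_one_le N m)

end Rewinding

theorem stmt_0 :
    ∀ n : ℕ, 3 ≤ n → ∃ c : ℝ, 0 < c ∧
      ∀ (Ω : Type) [Fintype Ω] [DecidableEq Ω] (M : Canonical Ω) (a b : Ω) (Q : ℕ),
        Fintype.card Ω = n → AQC M a b = (Q : ℝ≥0∞) → 2 ≤ Q →
        NAQC M a b ≤ ENNReal.ofReal (c * ((Q : ℝ) * Real.log Q) ^ (2 * (n - 2))) := by
  intro n hn
  have hn0 : (3 : ℝ) ≤ n := by exact_mod_cast hn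
  have hl2 : 0 < Real.log 2 := Real.log_pos one_lt_two
  have hl0 : 0 < Real.log (32 * n ^ 3) := 
    Real.log_pos (by nlinarith [pow_le_pow_left₀ (by norm_num) hn0 3])
  set k : ℝ := Real.log (32 * n ^ 3) / Real.log 2 + 1 with hk
  have hk0 : 0 < k := by positivity
  set K : ℝ := 1024 * n ^ 4 * k / Real.log 2 + 1 / (2 * Real.log 2 ^ 2) with hK
  have hK0 : 0 < K := by positivity
  refine ⟨K ^ (n - 2), by positivity, fun Ω _ _ M a b Q hcard hAQC hQ => ?_⟩
  have hQ2 : (2 : ℝ) ≤ Q := by exact_mod_cast hQ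
  have hlQ : Real.log 2 ≤ Real.log Q := Real.log_le_log two_pos hQ2
  set x : ℝ := 1024 * n ^ 4 * k * (Q ^ 2 * Real.log Q) with hx
  have hx0 : 0 < x := by
    have : 0 < Real.log Q := hl2.trans_le hlQ
    positivity
  have hNx : x ≤ (⌈x⌉₊ : ℝ) := Nat.le_ceil x
  have hlog : Real.log (32 * n ^ 3 * Q) ≤ k * Real.log Q := by
    rw [Real.log_mul (by positivity) (by positivity), hk, add_mul, one_mul, div_mul_eq_mul_div]
    refine add_le_add ?_ le_rfl
    rw [le_div_iff₀ hl2]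
    exact mul_le_mul_of_nonneg_left hlQ hl0.le
  refine (Rewinding.NAQC_le_of_exp_le M (N := ⌈x⌉₊) (m := n - 2)
    (ε := 1 / (16 * n ^ 2 * Q)) (by omega) hAQC
    (Nat.ceil_pos.2 hx0) (by positivity) ?_ ?_ ?_).trans ?_
  · rw [div_le_div_iff₀ (by positivity) (by norm_num)]
    nlinarith
  · rw [hcard, mul_one_div, div_self (by positivity)]
  · rw [hcard]
    have h1 : k * Real.log Q ≤ ⌈x⌉₊ * (1 / (16 * (n : ℝ) ^ 2 * Q)) ^ 2 / 4 := by
      have h2 : x * (1 / (16 * (n : ℝ) ^ 2 * Q)) ^ 2 / 4 = k * Real.log Q := by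
        rw [hx]
        field_simp
        ring
      rw [← h2]
      gcongr
    calc 2 * (n : ℝ) * Real.exp (-(⌈x⌉₊ * (1 / (16 * (n : ℝ) ^ 2 * Q)) ^ 2 / 4))
        ≤ 2 * n * Real.exp (-Real.log (32 * n ^ 3 * Q)) := by
          gcongr
          exact hlog.trans h1
      _ = 1 / (16 * n ^ 2 * Q) := by
          rw [Real.exp_neg, Real.exp_log (by positivity)]
          field_simp
          norm_num
  · rw [pow_mul, ← mul_pow, ← ENNReal.ofReal_natCast]
    refine ENNReal.ofReal_le_ofReal ?_
    push_cast
    refine pow_le_pow_left₀ (by positivity) ?_ _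
    have h1 : (⌈x⌉₊ : ℝ) < x + 1 := Nat.ceil_lt_add_one hx0.le
    have h2 : x ≤ 1024 * n ^ 4 * k / Real.log 2 * (Q * Real.log Q) ^ 2 := by
      rw [div_mul_eq_mul_div, le_div_iff₀ hl2, hx]
      calc _ = 1024 * n ^ 4 * k * Q ^ 2 * Real.log Q * Real.log 2 := by ring
        _ ≤ 1024 * n ^ 4 * k * Q ^ 2 * Real.log Q * Real.log Q := by
          have : 0 < Real.log Q := hl2.trans_le hlQ
          gcongr
        _ = _ := by ring
    have h3 : 2 ≤ 1 / (2 * Real.log 2 ^ 2) * (Q * Real.log Q) ^ 2 := by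
      have h4 : (2 * Real.log 2) ^ 2 ≤ (Q * Real.log Q) ^ 2 := by gcongr
      rw [div_mul_eq_mul_div, le_div_iff₀ (by positivity)]
      nlinarith
    rw [hK, add_mul]
    linarith
end

section
/- Let M = (Ω, P) be a canonical partially observable Markov chain and let a, b ∈ Ω. If there exists a rewinding strategy A with QC^A_M(a,b) < ∞, then there exists a non-adaptive rewinding strategy A' with QC^{A'}_M(a,b) < ∞; that is, any pair of states distinguishable by some rewinding strategy is also distinguishable by a non-adaptive rewinding strategy. -/
open Finset
open scoped ENNReal

variable {Ω : Type} [Fintype Ω] [DecidableEq Ω]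

theorem QC_ne_top_iff (M : Canonical Ω) (A : List Bool → ℕ) (a b : Ω) :
    QC M A a b ≠ ⊤ ↔ ∃ T : ℕ, 1 / 3 ≤ obsTV M A a b T := by
  constructor
  · intro h
    by_contra! hT
    refine h ?_
    rw [QC, sInf_eq_top]
    rintro x ⟨T, -, hx⟩
    exact absurd hx (not_le.2 (hT T))
  · rintro ⟨T, hT⟩
    exact ne_top_of_le_ne_top (ENNReal.natCast_ne_top T) (sInf_le ⟨T, rfl, hT⟩)

/-- Total variation is bounded below through the Bhattacharyya coefficient. -/
theorem one_sub_sum_sqrt_le {α : Type*} [Fintype α] (p q : α → ℝ)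
    (hp : ∀ i, 0 ≤ p i) (hq : ∀ i, 0 ≤ q i) (hp1 : ∑ i, p i = 1) (hq1 : ∑ i, q i = 1) :
    1 - ∑ i, √(p i) * √(q i) ≤ (1 / 2) * ∑ i, |p i - q i| := by
  have key : ∀ i, p i + q i - 2 * (√(p i) * √(q i)) ≤ |p i - q i| := by
    intro i
    have h1 := Real.mul_self_sqrt (hp i)
    have h2 := Real.mul_self_sqrt (hq i)
    have h3 := Real.sqrt_nonneg (p i)
    have h4 := Real.sqrt_nonneg (q i)
    rcases le_total √(p i) √(q i) with h | h
    · refine le_trans ?_ (neg_le_abs _)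
      nlinarith [mul_le_mul_of_nonneg_left h h3]
    · refine le_trans ?_ (le_abs_self _)
      nlinarith [mul_le_mul_of_nonneg_left h h4]
  have h := Finset.sum_le_sum fun i (_ : i ∈ univ) => key i
  rw [Finset.sum_sub_distrib, Finset.sum_add_distrib, hp1, hq1, ← Finset.mul_sum] at h
  linarith

theorem sum_sqrt_lt_one {α : Type*} [Fintype α] (p q : α → ℝ)
    (hp : ∀ i, 0 ≤ p i) (hq : ∀ i, 0 ≤ q i) (hp1 : ∑ i, p i = 1) (hq1 : ∑ i, q i = 1)
    (hne : p ≠ q) : ∑ i, √(p i) * √(q i) < 1 := by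
  obtain ⟨j, hj⟩ := Function.ne_iff.1 hne
  have hpos : 0 < ∑ i, (√(p i) - √(q i)) ^ 2 := by
    refine Finset.sum_pos' (fun i _ => sq_nonneg _) ⟨j, Finset.mem_univ j, ?_⟩
    have : √(p j) ≠ √(q j) := fun h => hj ((Real.sqrt_inj (hp j) (hq j)).1 h)
    have := sub_ne_zero.2 this
    positivity
  have hexp : ∀ i, (√(p i) - √(q i)) ^ 2 = p i + q i - 2 * (√(p i) * √(q i)) := by
    intro i
    nlinarith [Real.mul_self_sqrt (hp i), Real.mul_self_sqrt (hq i)]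
  simp_rw [hexp] at hpos
  rw [Finset.sum_sub_distrib, Finset.sum_add_distrib, hp1, hq1, ← Finset.mul_sum] at hpos
  linarith

theorem sum_fin_succ_arrow {α : Type*} [Fintype α] {n : ℕ} (F : (Fin (n + 1) → α) → ℝ) :
    ∑ f, F f = ∑ y, ∑ g : Fin n → α, F (Fin.cons y g) := by
  rw [← (Fin.consEquiv fun _ : Fin (n + 1) => α).sum_comp, Fintype.sum_prod_type]
  rfl

/-- The law of a sequence drawn from causal probability kernels has total mass one. -/
theorem sum_prod_causal_eq_one {α : Type*} [Fintype α] [Nonempty α] (n : ℕ) (K : Fin n → (Fin n → α) → α → ℝ)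
    (hK : ∀ i g, ∑ y, K i g y = 1)
    (hcausal : ∀ i g g', (∀ j < i, g j = g' j) → K i g = K i g') :
    ∑ g : Fin n → α, ∏ i, K i g (g i) = 1 := by
  induction n with
  | zero => simp
  | succ n ih =>
    obtain ⟨c⟩ := ‹Nonempty α›
    rw [sum_fin_succ_arrow]
    have h0 : ∀ g, K 0 g = K 0 fun _ => c := fun g => hcausal 0 _ _ (by simp)
    rw [← hK 0 fun _ => c]
    refine Finset.sum_congr rfl fun y _ => ?_
    simp only [Fin.prod_univ_succ, Fin.cons_zero, Fin.cons_succ, h0]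
    rw [← Finset.mul_sum, ih (fun i g => K i.succ (Fin.cons y g)) (fun i g => hK _ _), mul_one]
    intro i g g' h
    refine hcausal _ _ _ fun j hj => ?_
    induction j using Fin.cases with
    | zero => rfl
    | succ j => simpa using h j (by simpa using hj)

/-- Probability of the observations `w` when each node `i` is sampled from its parent `p i`,
where `none` stands for the root, whose state is `x`. -/
noncomputable def treeProb {ι : Type*} [Fintype ι] [DecidableEq ι] (M : Canonical Ω)
    (p : ι → Option ι) (x : Ω) (w : ι → Bool) : ℝ :=
  ∑ g : ι → Ω, ∏ i, if M.obs (g i) = w i then M.P ((p i).elim x g) (g i) else 0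

theorem treeProb_nonneg {ι : Type*} [Fintype ι] [DecidableEq ι] (M : Canonical Ω)
    (p : ι → Option ι) (x : Ω) (w : ι → Bool) : 0 ≤ treeProb M p x w :=
  Finset.sum_nonneg fun g _ => Finset.prod_nonneg fun i _ => by
    split_ifs
    exacts [M.nonneg _ _, le_rfl]

theorem sum_treeProb (M : Canonical Ω) {n : ℕ} (p : Fin n → Option (Fin n))
    (hp : ∀ i, ∀ j ∈ p i, j < i) (x : Ω) : ∑ w, treeProb M p x w = 1 := by
  unfold treeProb
  rw [Finset.sum_comm]
  have : Nonempty Ω := ⟨M.sink⟩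
  rw [← sum_prod_causal_eq_one n (fun i g => M.P ((p i).elim x g)) (fun i g => M.sum_one _)]
  · refine Finset.sum_congr rfl fun g _ => ?_
    rw [← Fintype.piFinset_univ, ← Finset.prod_univ_sum (fun _ => univ)
      (fun i b => if M.obs (g i) = b then M.P ((p i).elim x g) (g i) else 0)]
    simp
  · intro i g g' h
    cases hpi : p i with
    | none => rfl
    | some j => simp [h j (hp i j hpi)]

theorem treeProb_equiv {ι κ : Type*} [Fintype ι] [DecidableEq ι] [Fintype κ] [DecidableEq κ]
    (e : ι ≃ κ) (M : Canonical Ω) (p : ι → Option ι) (x : Ω) (w : κ → Bool) :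
    treeProb M (fun k => (p (e.symm k)).map e) x w = treeProb M p x (w ∘ e) := by
  unfold treeProb
  rw [← (e.arrowCongr (Equiv.refl Ω)).sum_comp]
  refine Finset.sum_congr rfl fun g _ => ?_
  rw [← e.prod_comp]
  refine Finset.prod_congr rfl fun i _ => ?_
  cases h : p i <;> simp [h, Equiv.arrowCongr]

/-- Independent copies of a tree glued at the root. -/
def copies {ι : Type*} (κ : Type*) (p : ι → Option ι) (k : κ × ι) : Option (κ × ι) :=
  (p k.2).map (Prod.mk k.1)

theorem treeProb_copies {ι κ : Type*} [Fintype ι] [DecidableEq ι] [Fintype κ] [DecidableEq κ]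
    (M : Canonical Ω) (p : ι → Option ι) (x : Ω) (w : κ × ι → Bool) :
    treeProb M (copies κ p) x w = ∏ k, treeProb M p x fun i => w (k, i) := by
  unfold treeProb
  rw [Finset.prod_univ_sum, Fintype.piFinset_univ, ← (Equiv.curry κ ι Ω).sum_comp]
  refine Finset.sum_congr rfl fun g _ => ?_
  rw [Fintype.prod_prod_type]
  refine Finset.prod_congr rfl fun k _ => Finset.prod_congr rfl fun i _ => ?_
  cases h : p i <;> simp [copies, h]

theorem sum_sqrt_treeProb_copies {ι κ : Type*} [Fintype ι] [DecidableEq ι] [Fintype κ]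
    [DecidableEq κ] (M : Canonical Ω) (p : ι → Option ι) (a b : Ω) :
    ∑ w, √(treeProb M (copies κ p) a w) * √(treeProb M (copies κ p) b w) =
      (∑ w, √(treeProb M p a w) * √(treeProb M p b w)) ^ Fintype.card κ := by
  rw [← Finset.card_univ, ← Finset.prod_const, Finset.prod_univ_sum, Fintype.piFinset_univ,
    ← (Equiv.curry κ ι Bool).sum_comp]
  refine Finset.sum_congr rfl fun w _ => ?_
  rw [treeProb_copies, treeProb_copies, Real.sqrt_prod _ fun _ _ => treeProb_nonneg _ _ _ _,
    Real.sqrt_prod _ fun _ _ => treeProb_nonneg _ _ _ _, ← Finset.prod_mul_distrib]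
  rfl

theorem obsSeqProb_eq_treeProb (M : Canonical Ω) (A : List Bool → ℕ) (x : Ω) {n : ℕ}
    (z : Fin (n + 1) → Bool) (p : Fin n → Option (Fin n))
    (h : ∀ i : Fin n, (i : ℕ) - A ((List.range (i + 1)).map (extendTraj n z)) =
      (p i).elim 0 fun j => (j : ℕ) + 1) :
    obsSeqProb M A x n z = if M.obs x = z 0 then treeProb M p x fun i => z i.succ else 0 := by
  have hext : ∀ (f : Fin (n + 1) → Ω) (i : Fin (n + 1)), extendTraj n f i = f i := by
    intro f i
    unfold extendTraj
    congr 1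
    ext
    simp
    omega
  unfold obsSeqProb treeProb
  rw [sum_fin_succ_arrow, Finset.sum_eq_single x]
  · simp only [Fin.cons_zero, true_and, Fin.forall_fin_succ, Fin.cons_succ]
    split_ifs with hx
    · refine Finset.sum_congr rfl fun g _ => ?_
      split_ifs with hg
      · unfold trajProb
        rw [Finset.prod_range]
        refine Finset.prod_congr rfl fun i _ => ?_
        have hist : obsHist M (extendTraj n (Fin.cons x g)) i =
            (List.range (i + 1)).map (extendTraj n z) := by
          unfold obsHist
          refine List.map_congr_left fun t _ => ?_
          unfold extendTraj
          generalize (⟨min t n, _⟩ : Fin (n + 1)) = s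
          induction s using Fin.cases with
          | zero => exact hx
          | succ s => exact hg.2 s
        rw [if_pos (hg.2 i), hist, h i]
        congr 1
        · cases p i with
          | none => exact hext _ 0
          | some j => exact hext _ j.succ
        · exact hext _ i.succ
      · rw [eq_comm, Finset.prod_eq_zero_iff]
        push Not at hg
        obtain ⟨i, hi⟩ := hg hx
        exact ⟨i, Finset.mem_univ i, if_neg hi⟩
    · simp [hx]
  · intro y _ hy
    refine Finset.sum_eq_zero fun g _ => if_neg ?_
    simp [hy]
  · simp

/-- The non-adaptive strategy sampling according to the parent function `p`. -/
def treeStrategy {n : ℕ} (p : Fin n → Option (Fin n)) (l : List Bool) : ℕ :=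
  if h : l.length - 1 < n then
    (l.length - 1) - (p ⟨l.length - 1, h⟩).elim 0 fun j => (j : ℕ) + 1
  else 0

theorem nonAdaptive_treeStrategy {n : ℕ} (p : Fin n → Option (Fin n)) :
    NonAdaptive (treeStrategy p) := by
  intro l₁ l₂ h
  simp only [treeStrategy, h]

theorem obsSeqProb_treeStrategy (M : Canonical Ω) {n : ℕ} (p : Fin n → Option (Fin n))
    (hp : ∀ i, ∀ j ∈ p i, j < i) (x : Ω) (z : Fin (n + 1) → Bool) :
    obsSeqProb M (treeStrategy p) x n z =
      if M.obs x = z 0 then treeProb M p x fun i => z i.succ else 0 := by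
  refine obsSeqProb_eq_treeProb M _ x z p fun i => ?_
  have hi := i.2
  cases hpi : p i with
  | none => simp [treeStrategy, hpi]
  | some j =>
    have := hp i j hpi
    simp [treeStrategy, hpi]
    omega

theorem one_sub_le_obsTV_treeStrategy (M : Canonical Ω) {n : ℕ} (p : Fin n → Option (Fin n))
    (hp : ∀ i, ∀ j ∈ p i, j < i) (a b : Ω) :
    1 - (if M.obs a = M.obs b then ∑ w, √(treeProb M p a w) * √(treeProb M p b w) else 0) ≤
      obsTV M (treeStrategy p) a b n := by
  have hsum : ∀ x, ∑ z, obsSeqProb M (treeStrategy p) x n z = 1 := by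
    intro x
    simp_rw [obsSeqProb_treeStrategy M p hp]
    rw [sum_fin_succ_arrow, Finset.sum_comm, ← sum_treeProb M p hp x]
    simp
  have hnn : ∀ x z, 0 ≤ obsSeqProb M (treeStrategy p) x n z := by
    intro x z
    rw [obsSeqProb_treeStrategy M p hp]
    split_ifs
    exacts [treeProb_nonneg _ _ _ _, le_rfl]
  refine le_trans (le_of_eq ?_)
    (one_sub_sum_sqrt_le _ _ (hnn a) (hnn b) (hsum a) (hsum b))
  congr 1
  simp_rw [obsSeqProb_treeStrategy M p hp]
  rw [sum_fin_succ_arrow, Finset.sum_comm]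
  simp only [Fin.cons_zero, Fin.cons_succ]
  split_ifs with hab
  · refine Finset.sum_congr rfl fun w _ => ?_
    rw [Finset.sum_eq_single (M.obs b)]
    · simp [hab]
    · intro c _ hc
      simp [hab, hc.symm]
    · simp
  · symm
    refine Finset.sum_eq_zero fun w _ => Finset.sum_eq_zero fun c _ => ?_
    by_cases hc : M.obs a = c
    · have : M.obs b ≠ c := fun h => hab (hc.trans h.symm)
      simp [this]
    · simp [hc]

theorem exists_treeProb_ne (M : Canonical Ω) (A : List Bool → ℕ) (a b : Ω) (n : ℕ)
    (hab : M.obs a = M.obs b) (h : 0 < obsTV M A a b n) :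
    ∃ p : Fin n → Option (Fin n), (∀ i, ∀ j ∈ p i, j < i) ∧ treeProb M p a ≠ treeProb M p b := by
  have hz : ∃ z, obsSeqProb M A a n z ≠ obsSeqProb M A b n z := by
    by_contra! hz
    simp [obsTV, hz] at h
  obtain ⟨z, hz⟩ := hz
  have hpar : ∀ i : Fin n, ∃ q : Option (Fin n), (∀ j ∈ q, j < i) ∧
      (i : ℕ) - A ((List.range (i + 1)).map (extendTraj n z)) = q.elim 0 fun j => (j : ℕ) + 1 := by
    intro i
    have hi := i.2
    rcases hs : (i : ℕ) - A ((List.range (i + 1)).map (extendTraj n z)) with _ | s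
    · exact ⟨none, by simp, rfl⟩
    · exact ⟨some ⟨s, by omega⟩, by rintro j ⟨⟩; exact Fin.mk_lt_of_lt_val (by omega), rfl⟩
  choose p hp hpA using hpar
  refine ⟨p, hp, fun heq => hz ?_⟩
  rw [obsSeqProb_eq_treeProb M A a z p hpA, obsSeqProb_eq_treeProb M A b z p hpA, heq, hab]

theorem stmt_1 {Ω : Type} [Fintype Ω] [DecidableEq Ω] (M : Canonical Ω) (a b : Ω)
    (h : ∃ A : List Bool → ℕ, QC M A a b ≠ ⊤) :
    ∃ A' : List Bool → ℕ, NonAdaptive A' ∧ QC M A' a b ≠ ⊤ := by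
  obtain ⟨A, hA⟩ := h
  obtain ⟨n, hn⟩ := (QC_ne_top_iff M A a b).1 hA
  suffices ∃ (m : ℕ) (q : Fin m → Option (Fin m)), (∀ i, ∀ j ∈ q i, j < i) ∧
      (if M.obs a = M.obs b then ∑ w, √(treeProb M q a w) * √(treeProb M q b w) else 0) ≤
        (2 / 3 : ℝ) by
    obtain ⟨m, q, hq, hle⟩ := this
    refine ⟨treeStrategy q, nonAdaptive_treeStrategy q, (QC_ne_top_iff _ _ _ _).2 ⟨m, ?_⟩⟩
    linarith [one_sub_le_obsTV_treeStrategy M q hq a b]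
  by_cases hab : M.obs a = M.obs b
  · obtain ⟨p, hp, hne⟩ := exists_treeProb_ne M A a b n hab (by linarith)
    have hlt := sum_sqrt_lt_one _ _ (treeProb_nonneg M p a) (treeProb_nonneg M p b)
      (sum_treeProb M p hp a) (sum_treeProb M p hp b) hne
    obtain ⟨N, hN⟩ := exists_pow_lt_of_lt_one (show (0 : ℝ) < 2 / 3 by norm_num) hlt
    let e : Fin N × Fin n ≃ Fin (N * n) := finProdFinEquiv
    refine ⟨N * n, fun k => (copies (Fin N) p (e.symm k)).map e, ?_, ?_⟩
    · intro k j hj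
      obtain ⟨⟨i, r⟩, rfl⟩ := e.surjective k
      simp only [Equiv.symm_apply_apply, copies, Option.map_map, Option.mem_def,
        Option.map_eq_some_iff] at hj
      obtain ⟨s, hs, rfl⟩ := hj
      have := hp r s hs
      rw [Fin.lt_def] at this ⊢
      simpa [e] using this
    · simp only [if_pos hab, treeProb_equiv e]
      change ∑ x, (fun w => √(treeProb M (copies (Fin N) p) a w) *
        √(treeProb M (copies (Fin N) p) b w)) (e.symm.arrowCongr (Equiv.refl Bool) x) ≤ _
      rw [(e.symm.arrowCongr (Equiv.refl Bool)).sum_comp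
        fun w => √(treeProb M (copies (Fin N) p) a w) * √(treeProb M (copies (Fin N) p) b w),
        sum_sqrt_treeProb_copies, Fintype.card_fin]
      exact hN.le
  · exact ⟨0, Fin.elim0, fun i => i.elim0, by rw [if_neg hab]; norm_num⟩
end

section
/- There exist absolute constants C > 0 and c > 0 such that for every integer n ≥ 4 and every integer d ≥ 2 there exists a canonical partially observable Markov chain M with exactly n states and two states a, b of M satisfying AQC_M(a,b) ≤ C · n² · d and NAQC_M(a,b) ≥ c · min( dⁿ , d^{n−2} · (2e·ln d)^{−n} ). -/
open Finset
open scoped ENNReal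

variable {Ω : Type} [Fintype Ω] [DecidableEq Ω]

/-- Lowering a level by one, with `0` fixed. -/
def lower {m : ℕ} (x : Fin (m + 1)) : Fin (m + 1) := ⟨x.val - 1, by omega⟩

/-- The chain on levels `0, …, m` that lowers the level by one with probability `q` and falls
to the sink `0` with probability `1 - q`. -/
noncomputable def decayChain (m : ℕ) (q : ℝ) (h0 : 0 ≤ q) (h1 : q ≤ 1) :
    Canonical (Fin (m + 1)) where
  P x y := q * (if y = lower x then 1 else 0) + (1 - q) * (if y = 0 then 1 else 0)
  sink := 0
  nonneg x y := by
    have : 0 ≤ 1 - q := by linarith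
    positivity
  sum_one x := by
    simp [Finset.sum_add_distrib]
  sink_absorb := by
    have : (0 : Fin (m + 1)) = lower 0 := rfl
    simp [← this]

theorem obsHist_congr (M : Canonical Ω) {g h : ℕ → Ω} {t : ℕ} (hgh : ∀ i ≤ t, g i = h i) :
    obsHist M g t = obsHist M h t := by
  refine List.map_congr_left fun i hi => ?_
  rw [hgh i (by simpa [Nat.lt_succ_iff] using hi)]

theorem obsHist_succ (M : Canonical Ω) (g : ℕ → Ω) (t : ℕ) :
    obsHist M g (t + 1) = obsHist M g t ++ [M.obs (g (t + 1))] := by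
  simp [obsHist, List.range_succ]

theorem obsHist_length (M : Canonical Ω) (g : ℕ → Ω) (t : ℕ) :
    (obsHist M g t).length = t + 1 := by
  simp [obsHist]

section Coupling

variable {m : ℕ} (M : Canonical (Fin (m + 1))) (A : List Bool → ℕ) (x : Fin (m + 1))
  (U : Finset ℕ)

/-- The trajectory up to time `t`, driven by the set `U` of times at which the level is lowered
rather than reset to `0`. -/
def runUpTo : ℕ → ℕ → Fin (m + 1)
  | 0 => fun _ => x
  | t + 1 => Function.update (runUpTo t) (t + 1)
      (if t ∈ U then lower (runUpTo t (t - A (obsHist M (runUpTo t) t))) else 0)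

/-- The trajectory from `x` driven by the set `U` of times at which the level is lowered. -/
def run (t : ℕ) : Fin (m + 1) := runUpTo M A x U t t

theorem runUpTo_eq_run {s i : ℕ} (h : i ≤ s) : runUpTo M A x U s i = run M A x U i := by
  induction s, h using Nat.le_induction with
  | base => rfl
  | succ s hs ih => rw [runUpTo, Function.update_of_ne (by omega), ih]

theorem run_zero : run M A x U 0 = x := rfl

theorem run_succ (t : ℕ) : run M A x U (t + 1) =
    if t ∈ U then lower (run M A x U (t - A (obsHist M (run M A x U) t))) else 0 := by
  rw [run, runUpTo, Function.update_self,
    obsHist_congr M (fun i hi => runUpTo_eq_run M A x U hi),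
    runUpTo_eq_run M A x U (Nat.sub_le _ _)]

theorem eq_run_of_step {T : ℕ} {g : ℕ → Fin (m + 1)} (h0 : g 0 = x)
    (hs : ∀ t < T, g (t + 1) = if t ∈ U then lower (g (t - A (obsHist M g t))) else 0) :
    ∀ t ≤ T, g t = run M A x U t := by
  intro t
  induction t using Nat.strong_induction_on with
  | _ t ih =>
    intro ht
    rcases t with _ | t
    · exact h0
    · have hg : ∀ i ≤ t, g i = run M A x U i := fun i hi => ih i (by omega) (by omega)
      rw [hs t (by omega), run_succ, obsHist_congr M hg, hg _ (Nat.sub_le _ _)]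

end Coupling

/-- The probability that independent coins with bias `q`, indexed by `range T`, come up heads
exactly on `U`. -/
noncomputable def coinWeight (q : ℝ) (T : ℕ) (U : Finset ℕ) : ℝ :=
  q ^ #U * (1 - q) ^ #(range T \ U)

theorem coinWeight_nonneg {q : ℝ} (h0 : 0 ≤ q) (h1 : q ≤ 1) (T : ℕ) (U : Finset ℕ) :
    0 ≤ coinWeight q T U := by
  have : 0 ≤ 1 - q := by linarith
  unfold coinWeight
  positivity

theorem sum_coinWeight (q : ℝ) (T : ℕ) : ∑ U ∈ (range T).powerset, coinWeight q T U = 1 := by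
  have := Finset.prod_add (fun _ : ℕ => q) (fun _ => 1 - q) (range T)
  simp only [Finset.prod_const] at this
  unfold coinWeight
  rw [← this]
  simp

theorem sum_coinWeight_superset (q : ℝ) {T : ℕ} {S : Finset ℕ} (hS : S ⊆ range T) :
    ∑ U ∈ (range T).powerset, (if S ⊆ U then coinWeight q T U else 0) = q ^ #S := by
  have key := Finset.prod_add (fun _ : ℕ => q) (fun t => if t ∈ S then 0 else 1 - q) (range T)
  have hl : ∏ t ∈ range T, (q + if t ∈ S then 0 else 1 - q) = q ^ #S := by
    have : ∀ t ∈ range T, (q + if t ∈ S then 0 else 1 - q) = if t ∈ S then q else 1 := by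
      intro t _
      split_ifs <;> ring
    rw [Finset.prod_congr rfl this, Finset.prod_ite_mem, Finset.inter_eq_right.mpr hS,
      Finset.prod_const]
  rw [← hl, key]
  refine Finset.sum_congr rfl fun U _ => ?_
  rw [Finset.prod_const]
  split_ifs with h
  · have hsd : ∀ t ∈ range T \ U, (if t ∈ S then 0 else 1 - q) = 1 - q := fun t ht =>
      if_neg fun hts => (Finset.mem_sdiff.mp ht).2 (h hts)
    rw [coinWeight, Finset.prod_congr rfl hsd, Finset.prod_const]
  · obtain ⟨t, hts, htU⟩ := Finset.not_subset.mp h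
    rw [Finset.prod_eq_zero (Finset.mem_sdiff.mpr ⟨hS hts, htU⟩) (by simp [hts]), mul_zero]

theorem sum_coinWeight_card_lt_le {q : ℝ} (h0 : 0 ≤ q) (h1 : q ≤ 1) (T k : ℕ) :
    ∑ U ∈ (range T).powerset, (if #U < k then coinWeight q T U else 0) ≤
      2 ^ k * (1 - q / 2) ^ T := by
  have key := Finset.prod_add (fun _ : ℕ => q / 2) (fun _ => 1 - q) (range T)
  simp only [Finset.prod_const, Finset.card_range] at key
  rw [show 1 - q / 2 = q / 2 + (1 - q) by ring, key, Finset.mul_sum]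
  refine Finset.sum_le_sum fun U _ => ?_
  have hw := coinWeight_nonneg h0 h1 T U
  have he : (2 : ℝ) ^ k * ((q / 2) ^ #U * (1 - q) ^ #(range T \ U)) =
      2 ^ k / 2 ^ #U * coinWeight q T U := by
    rw [coinWeight, div_pow]
    ring
  rw [he]
  split_ifs with h
  · refine le_mul_of_one_le_left hw ?_
    rw [one_le_div (by positivity)]
    exact pow_le_pow_right₀ (by norm_num) h.le
  · positivity

section Decay

variable {m : ℕ} {q : ℝ} (h0 : 0 ≤ q) (h1 : q ≤ 1)

theorem trajProb_decayChain (A : List Bool → ℕ) (T : ℕ) (g : ℕ → Fin (m + 1)) :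
    trajProb (decayChain m q h0 h1) A T g =
      ∑ U ∈ (range T).powerset, if ∀ t < T, g (t + 1) =
        if t ∈ U then lower (g (t - A (obsHist (decayChain m q h0 h1) g t))) else 0
      then coinWeight q T U else 0 := by
  set M := decayChain m q h0 h1
  have : trajProb M A T g = ∏ t ∈ range T,
      (q * (if g (t + 1) = lower (g (t - A (obsHist M g t))) then 1 else 0) +
        (1 - q) * (if g (t + 1) = 0 then 1 else 0)) := rfl
  rw [this, Finset.prod_add]
  refine Finset.sum_congr rfl fun U hU => ?_
  rw [Finset.mem_powerset] at hU
  rw [Finset.prod_mul_distrib, Finset.prod_mul_distrib, Finset.prod_const, Finset.prod_const,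
    Finset.prod_ite_zero, Finset.prod_ite_zero, Finset.prod_const_one, Finset.prod_const_one,
    coinWeight]
  by_cases h : ∀ t < T, g (t + 1) =
        if t ∈ U then lower (g (t - A (obsHist M g t))) else 0
  · rw [if_pos h, if_pos, if_pos]
    · ring
    · intro t ht
      rw [Finset.mem_sdiff, Finset.mem_range] at ht
      rw [h t ht.1, if_neg ht.2]
    · intro t ht
      rw [h t (Finset.mem_range.mp (hU ht)), if_pos ht]
  · rw [if_neg h]
    by_contra hne
    refine h fun t ht => ?_
    split_ifs with htU
    · by_contra hc
      exact hne (by rw [if_neg fun h' => hc (h' t htU)]; ring)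
    · by_contra hc
      refine hne ?_
      rw [mul_comm, if_neg (c := ∀ t ∈ range T \ U, g (t + 1) = 0)
        fun h' => hc (h' t (Finset.mem_sdiff.mpr ⟨Finset.mem_range.mpr ht, htU⟩))]
      ring

theorem obsSeqProb_decayChain (A : List Bool → ℕ) (x : Fin (m + 1)) (T : ℕ)
    (z : Fin (T + 1) → Bool) :
    obsSeqProb (decayChain m q h0 h1) A x T z =
      ∑ U ∈ (range T).powerset,
        if (fun i : Fin (T + 1) => (decayChain m q h0 h1).obs
          (run (decayChain m q h0 h1) A x U i)) = z
        then coinWeight q T U else 0 := by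
  set M := decayChain m q h0 h1
  unfold obsSeqProb
  have htp : ∀ g, trajProb M A T g = _ := trajProb_decayChain h0 h1 A T
  simp_rw [htp]
  rw [← Finset.sum_filter]
  rw [Finset.sum_comm]
  refine Finset.sum_congr rfl fun U _ => ?_
  rw [← Finset.sum_filter, Finset.filter_filter]
  have hext : ∀ f : Fin (T + 1) → Fin (m + 1), ∀ i : Fin (T + 1), extendTraj T f i = f i := by
    intro f i
    unfold extendTraj
    congr 1
    ext
    exact min_eq_left (by omega)
  set r : Fin (T + 1) → Fin (m + 1) := fun i => run M A x U i
  have hrext : ∀ i ≤ T, extendTraj T r i = run M A x U i := fun i hi =>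
    hext r ⟨i, by omega⟩
  have hfil : ∀ f : Fin (T + 1) → Fin (m + 1),
      ((f 0 = x ∧ ∀ i, M.obs (f i) = z i) ∧ ∀ t < T, extendTraj T f (t + 1) =
        if t ∈ U then lower (extendTraj T f (t - A (obsHist M (extendTraj T f) t))) else 0) ↔
      f = r ∧ (fun i => M.obs (r i)) = z := by
    intro f
    constructor
    · rintro ⟨⟨hx, hz⟩, hs⟩
      have hf : f = r := by
        funext i
        rw [← hext f i]
        exact eq_run_of_step M A x U ((hext f 0).trans hx) hs i (by omega)
      exact ⟨hf, funext fun i => hf ▸ hz i⟩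
    · rintro ⟨rfl, hz⟩
      refine ⟨⟨rfl, fun i => congrFun hz i⟩, fun t ht => ?_⟩
      rw [hrext _ (by omega), run_succ,
        obsHist_congr M (fun i hi => hrext i (by omega)), hrext _ (by omega)]
  rw [Finset.filter_congr fun f _ => hfil f]
  change _ = if (fun i => M.obs (r i)) = z then _ else _
  by_cases hz : (fun i => M.obs (r i)) = z
  · simp [hz, Finset.filter_eq']
  · simp [hz]

/-- The observations up to time `T` of the trajectory from `x` driven by `U`. -/
noncomputable def runObs (A : List Bool → ℕ) (x : Fin (m + 1)) (T : ℕ) (U : Finset ℕ)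
    (i : Fin (T + 1)) : Bool :=
  (decayChain m q h0 h1).obs (run (decayChain m q h0 h1) A x U i)

theorem obs_decayChain (x : Fin (m + 1)) :
    (decayChain m q h0 h1).obs x = decide (x.val = 0) := by
  unfold Canonical.obs
  congr 1
  exact propext Fin.ext_iff

theorem obsTV_decayChain_le (A : List Bool → ℕ) (a b : Fin (m + 1)) (T : ℕ) :
    obsTV (decayChain m q h0 h1) A a b T ≤ ∑ U ∈ (range T).powerset,
      if runObs h0 h1 A a T U ≠ runObs h0 h1 A b T U then coinWeight q T U else 0 := by
  set R := fun x U => runObs h0 h1 A x T U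
  have hx : ∀ x z, obsSeqProb (decayChain m q h0 h1) A x T z =
      ∑ U ∈ (range T).powerset, if R x U = z then coinWeight q T U else 0 :=
    fun x z => obsSeqProb_decayChain h0 h1 A x T z
  have hz : ∀ z, |obsSeqProb (decayChain m q h0 h1) A a T z -
      obsSeqProb (decayChain m q h0 h1) A b T z| ≤ ∑ U ∈ (range T).powerset,
        if R a U ≠ R b U then ((if R a U = z then coinWeight q T U else 0) +
          (if R b U = z then coinWeight q T U else 0)) else 0 := by
    intro z
    rw [hx, hx, ← Finset.sum_sub_distrib]
    refine (Finset.abs_sum_le_sum_abs _ _).trans (Finset.sum_le_sum fun U _ => ?_)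
    have hw := coinWeight_nonneg h0 h1 T U
    by_cases hab : R a U = R b U
    · simp [hab]
    · rw [if_pos hab]
      refine (abs_sub _ _).trans_eq ?_
      rw [abs_of_nonneg (by positivity), abs_of_nonneg (by positivity)]
  have hs := Finset.sum_le_sum fun z (_ : z ∈ (univ : Finset (Fin (T + 1) → Bool))) => hz z
  rw [Finset.sum_comm] at hs
  have hU : ∀ U, (∑ z, if R a U ≠ R b U then ((if R a U = z then coinWeight q T U else 0) +
      (if R b U = z then coinWeight q T U else 0)) else 0) =
      2 * if R a U ≠ R b U then coinWeight q T U else 0 := by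
    intro U
    split_ifs
    · rw [Finset.sum_add_distrib, Finset.sum_ite_eq, Finset.sum_ite_eq]
      simp [two_mul]
    · simp
  simp_rw [hU, ← Finset.mul_sum] at hs
  unfold obsTV
  linarith

theorem le_obsTV_decayChain (A : List Bool → ℕ) (a b : Fin (m + 1)) (T : ℕ)
    (E : (Fin (T + 1) → Bool) → Prop) [DecidablePred E] :
    1 / 2 * ((∑ U ∈ (range T).powerset,
        if E (runObs h0 h1 A a T U) then coinWeight q T U else 0) -
      ∑ U ∈ (range T).powerset,
        if E (runObs h0 h1 A b T U) then coinWeight q T U else 0) ≤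
      obsTV (decayChain m q h0 h1) A a b T := by
  have hx : ∀ x, (∑ U ∈ (range T).powerset,
      if E (runObs h0 h1 A x T U) then coinWeight q T U else 0) =
      ∑ z with E z, obsSeqProb (decayChain m q h0 h1) A x T z := by
    intro x
    have hz : ∀ z, obsSeqProb (decayChain m q h0 h1) A x T z = ∑ U ∈ (range T).powerset,
        if runObs h0 h1 A x T U = z then coinWeight q T U else 0 :=
      fun z => obsSeqProb_decayChain h0 h1 A x T z
    simp_rw [hz]
    rw [Finset.sum_comm]
    refine Finset.sum_congr rfl fun U _ => ?_
    rw [Finset.sum_ite_eq]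
    simp
  rw [hx, hx, ← Finset.sum_sub_distrib]
  unfold obsTV
  gcongr
  refine (Finset.sum_le_sum fun z _ => le_abs_self _).trans ?_
  exact Finset.sum_le_sum_of_subset_of_nonneg (Finset.filter_subset _ _)
    fun z _ _ => abs_nonneg _

end Decay

section NonAdaptiveBound

/-- The coins that decide whether the state at time `t` is alive, when the sampling at time `t`
rewinds by `k t`. -/
def ancestors (k : ℕ → ℕ) : ℕ → Finset ℕ
  | 0 => ∅
  | t + 1 => insert t (ancestors k (t - k t))
termination_by t => t
decreasing_by omega

theorem ancestors_zero (k : ℕ → ℕ) : ancestors k 0 = ∅ := by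
  rw [ancestors]

theorem ancestors_succ (k : ℕ → ℕ) (t : ℕ) :
    ancestors k (t + 1) = insert t (ancestors k (t - k t)) := by
  rw [ancestors]

theorem ancestors_subset_range (k : ℕ → ℕ) (t : ℕ) : ancestors k t ⊆ range t := by
  induction t using Nat.strong_induction_on with
  | _ t ih =>
    rcases t with _ | t
    · simp [ancestors_zero]
    · rw [ancestors_succ, Finset.insert_subset_iff]
      exact ⟨by simp, (ih (t - k t) (by omega)).trans (Finset.range_subset_range.mpr (by omega))⟩

theorem card_ancestors_succ (k : ℕ → ℕ) (t : ℕ) :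
    #(ancestors k (t + 1)) = #(ancestors k (t - k t)) + 1 := by
  rw [ancestors_succ, Finset.card_insert_of_notMem]
  intro h
  have := Finset.mem_range.mp (ancestors_subset_range k _ h)
  omega

variable {m : ℕ} {q : ℝ} (h0 : 0 ≤ q) (h1 : q ≤ 1)

theorem run_val_of_nonAdaptive (M : Canonical (Fin (m + 1))) {A : List Bool → ℕ}
    (hA : NonAdaptive A) (x : Fin (m + 1)) (U : Finset ℕ) (t : ℕ) :
    (run M A x U t).val =
      if ancestors (fun s => A (List.replicate (s + 1) false)) t ⊆ U then
        x.val - #(ancestors (fun s => A (List.replicate (s + 1) false)) t) else 0 := by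
  set k := fun s => A (List.replicate (s + 1) false)
  induction t using Nat.strong_induction_on with
  | _ t ih =>
    rcases t with _ | t
    · simp [ancestors_zero, run_zero]
    · have hp : A (obsHist M (run M A x U) t) = k t :=
        hA _ _ (by rw [obsHist_length, List.length_replicate])
      rw [run_succ, hp, card_ancestors_succ, ancestors_succ]
      simp only [Finset.insert_subset_iff]
      have := ih (t - k t) (by omega)
      by_cases htU : t ∈ U
      · by_cases hs : ancestors k (t - k t) ⊆ U
        · simp only [htU, hs, if_true, and_self] at this ⊢
          simp only [lower, this]
          omega
        · simp only [htU, hs, if_true, if_false, and_false] at this ⊢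
          simp only [lower, this]
      · simp [htU]

theorem obsTV_le_of_nonAdaptive {A : List Bool → ℕ} (hA : NonAdaptive A) (hm : 2 ≤ m)
    {a b : Fin (m + 1)} (ha : a.val = m) (hb : b.val = m - 1) (T : ℕ) :
    obsTV (decayChain m q h0 h1) A a b T ≤ T * q ^ (m - 1) := by
  refine (obsTV_decayChain_le h0 h1 A a b T).trans ?_
  set k := fun s => A (List.replicate (s + 1) false) with hk
  have hU : ∀ U, (if runObs h0 h1 A a T U ≠ runObs h0 h1 A b T U then coinWeight q T U else 0) ≤
      ∑ t ∈ range T, if #(ancestors k (t + 1)) = m - 1 then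
        (if ancestors k (t + 1) ⊆ U then coinWeight q T U else 0) else 0 := by
    intro U
    have hw := coinWeight_nonneg h0 h1 T U
    have hpos : ∀ t ∈ range T, 0 ≤ if #(ancestors k (t + 1)) = m - 1 then
        (if ancestors k (t + 1) ⊆ U then coinWeight q T U else 0) else 0 :=
      fun t _ => by positivity
    split_ifs with h
    · obtain ⟨i, hi⟩ := Function.ne_iff.mp h
      unfold runObs at hi
      rw [obs_decayChain, obs_decayChain, run_val_of_nonAdaptive _ hA,
        run_val_of_nonAdaptive _ hA, ← hk, ha, hb] at hi
      have hs : ancestors k i ⊆ U := by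
        by_contra hs
        simp [hs] at hi
      have hc : #(ancestors k i) = m - 1 := by
        by_contra hc
        simp only [hs, if_true, ne_eq, decide_eq_decide] at hi
        omega
      obtain ⟨i, hiT⟩ := i
      rcases i with _ | t
      · simp [ancestors_zero] at hc
        omega
      · refine le_trans ?_ (Finset.single_le_sum hpos (Finset.mem_range.mpr (by omega : t < T)))
        rw [if_pos hc, if_pos hs]
    · exact Finset.sum_nonneg hpos
  refine (Finset.sum_le_sum fun U _ => hU U).trans ?_
  rw [Finset.sum_comm]
  refine (Finset.sum_le_card_nsmul _ _ (q ^ (m - 1)) fun t ht => ?_).trans_eq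
    (by rw [Finset.card_range, nsmul_eq_mul])
  split_ifs with h
  · rw [sum_coinWeight_superset, h]
    refine (ancestors_subset_range k _).trans (Finset.range_subset_range.mpr ?_)
    have := Finset.mem_range.mp ht
    omega
  · rw [Finset.sum_const_zero]
    positivity

end NonAdaptiveBound

section AdaptiveBound

/-- The strategy that rewinds to the last time outside the sink. -/
def retry (l : List Bool) : ℕ := l.reverse.idxOf false

/-- The time to which `retry` rewinds from time `t`. -/
def lastAlive (M : Canonical Ω) (g : ℕ → Ω) (t : ℕ) : ℕ := t - retry (obsHist M g t)

theorem lastAlive_zero (M : Canonical Ω) (g : ℕ → Ω) : lastAlive M g 0 = 0 :=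
  Nat.zero_sub _

theorem lastAlive_succ (M : Canonical Ω) (g : ℕ → Ω) (t : ℕ) :
    lastAlive M g (t + 1) = if M.obs (g (t + 1)) = false then t + 1 else lastAlive M g t := by
  unfold lastAlive retry
  rw [obsHist_succ, List.reverse_append, List.reverse_singleton, List.singleton_append,
    List.idxOf_cons]
  cases M.obs (g (t + 1)) <;> simp

variable {m : ℕ} {q : ℝ} (h0 : 0 ≤ q) (h1 : q ≤ 1)

theorem run_retry (x : Fin (m + 1)) (hx : 1 ≤ x.val) (U : Finset ℕ) (t : ℕ) :
    let M := decayChain m q h0 h1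
    let g := run M retry x U
    (g (lastAlive M g t)).val = max 1 (x.val - #{s ∈ U | s < t}) ∧
      (g (lastAlive M g t)).val + #{i ∈ range (t + 1) | M.obs (g i) = false} = x.val + 1 := by
  intro M g
  have hobs : ∀ y : Fin (m + 1), M.obs y = decide (y.val = 0) := obs_decayChain h0 h1
  induction t with
  | zero =>
    have : g 0 = x := rfl
    have hx' : x ≠ 0 := fun h => by simp [h] at hx
    simp [lastAlive_zero, this, hobs, hx, hx', Finset.filter_singleton]
  | succ t ih =>
    obtain ⟨ih1, ih2⟩ := ih
    have hg : g (t + 1) = if t ∈ U then lower (g (lastAlive M g t)) else 0 :=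
      run_succ M retry x U t
    have hN : #{s ∈ U | s < t + 1} = #{s ∈ U | s < t} + if t ∈ U then 1 else 0 := by
      have : {s ∈ U | s < t + 1} = {s ∈ U | s < t} ∪ {s ∈ U | s = t} := by
        ext s
        simp only [Finset.mem_filter, Finset.mem_union, Nat.lt_succ_iff_lt_or_eq]
        tauto
      rw [this, Finset.card_union_of_disjoint, Finset.filter_eq']
      · split_ifs <;> simp
      · refine Finset.disjoint_filter.mpr fun s _ hs => by omega
    have hC : #{i ∈ range (t + 1 + 1) | M.obs (g i) = false} =
        #{i ∈ range (t + 1) | M.obs (g i) = false} +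
          if M.obs (g (t + 1)) = false then 1 else 0 := by
      rw [Finset.range_add_one (n := t + 1), Finset.filter_insert]
      split_ifs
      · rw [Finset.card_insert_of_notMem (by simp)]
      · rfl
    rw [lastAlive_succ, hN, hC]
    set L := g (lastAlive M g t)
    by_cases htU : t ∈ U
    · rw [if_pos htU] at hg
      have hv : (g (t + 1)).val = L.val - 1 := by rw [hg]; rfl
      by_cases hL : L.val = 1
      · have : M.obs (g (t + 1)) = true := by rw [hobs, hv, hL]; rfl
        simp only [this, htU, if_true, Bool.true_eq_false, if_false]
        change L.val = _ ∧ L.val + _ = _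
        omega
      · have : M.obs (g (t + 1)) = false := by
          rw [hobs, hv, decide_eq_false_iff_not]
          omega
        simp only [this, htU, if_true, hv]
        omega
    · rw [if_neg htU] at hg
      have : M.obs (g (t + 1)) = true := by rw [hobs, hg]; rfl
      simp only [this, htU, if_false, Bool.true_eq_false]
      exact ⟨ih1, ih2⟩

theorem card_runObs_retry (x : Fin (m + 1)) (hx : 1 ≤ x.val) {T : ℕ} {U : Finset ℕ}
    (hU : U ⊆ range T) :
    #{i | runObs h0 h1 retry x T U i = false} = x.val + 1 - max 1 (x.val - #U) := by
  obtain ⟨hL, hC⟩ := run_retry h0 h1 x hx U T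
  have hUT : {s ∈ U | s < T} = U :=
    Finset.filter_true_of_mem fun s hs => Finset.mem_range.mp (hU hs)
  have hcard : #{i | runObs h0 h1 retry x T U i = false} =
      #{i ∈ range (T + 1) | (decayChain m q h0 h1).obs
        (run (decayChain m q h0 h1) retry x U i) = false} := by
    rw [Finset.card_filter, Finset.card_filter, ← Fin.sum_univ_eq_sum_range]
    rfl
  rw [hUT] at hL
  rw [hcard]
  omega

theorem le_obsTV_retry (hm : 2 ≤ m) {a b : Fin (m + 1)} (ha : a.val = m) (hb : b.val = m - 1)
    (T : ℕ) :
    1 / 2 * (1 - 2 ^ (m - 1) * (1 - q / 2) ^ T) ≤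
      obsTV (decayChain m q h0 h1) retry a b T := by
  refine le_trans ?_ (le_obsTV_decayChain h0 h1 retry a b T fun z => m ≤ #{i | z i = false})
  have hzero : (∑ U ∈ (range T).powerset,
      if m ≤ #{i | runObs h0 h1 retry b T U i = false} then coinWeight q T U else 0) = 0 := by
    refine Finset.sum_eq_zero fun U hU => if_neg ?_
    rw [card_runObs_retry h0 h1 b (by omega) (Finset.mem_powerset.mp hU)]
    omega
  have hone : (∑ U ∈ (range T).powerset,
      if m ≤ #{i | runObs h0 h1 retry a T U i = false} then coinWeight q T U else 0) +
      ∑ U ∈ (range T).powerset, (if #U < m - 1 then coinWeight q T U else 0) = 1 := by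
    rw [← Finset.sum_add_distrib, ← sum_coinWeight q T]
    refine Finset.sum_congr rfl fun U hU => ?_
    rw [card_runObs_retry h0 h1 a (by omega) (Finset.mem_powerset.mp hU)]
    by_cases h : #U < m - 1
    · rw [if_neg (by omega), if_pos h, zero_add]
    · rw [if_pos (by omega), if_neg h, add_zero]
  have htail := sum_coinWeight_card_lt_le h0 h1 T (m - 1)
  rw [hzero]
  linarith

end AdaptiveBound

theorem QC_le {M : Canonical Ω} {A : List Bool → ℕ} {a b : Ω} {T : ℕ}
    (h : 1 / 3 ≤ obsTV M A a b T) : QC M A a b ≤ T :=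
  sInf_le ⟨T, rfl, h⟩

theorem two_pow_mul_one_sub_pow_le {m d : ℕ} (hm : 1 ≤ m) (hd : 1 ≤ d) :
    (2 : ℝ) ^ (m - 1) * (1 - (d : ℝ)⁻¹ / 2) ^ (4 * (m + 1) * d) ≤ 1 / 3 := by
  have hd' : (1 : ℝ) ≤ d := by exact_mod_cast hd
  have hi : (d : ℝ)⁻¹ ≤ 1 := inv_le_one_of_one_le₀ hd'
  have hexp : (1 - (d : ℝ)⁻¹ / 2) ^ (2 * d) ≤ 1 / 2 := by
    calc (1 - (d : ℝ)⁻¹ / 2) ^ (2 * d) ≤ Real.exp (-((d : ℝ)⁻¹ / 2)) ^ (2 * d) :=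
          pow_le_pow_left₀ (by linarith) (Real.one_sub_le_exp_neg _) _
      _ = Real.exp (-1) := by
          rw [← Real.exp_nat_mul]
          congr 1
          push_cast
          field_simp
      _ ≤ 1 / 2 := by
          rw [Real.exp_neg, one_div]
          have := Real.add_one_le_exp (1 : ℝ)
          exact inv_anti₀ (by norm_num) (by linarith)
  calc (2 : ℝ) ^ (m - 1) * (1 - (d : ℝ)⁻¹ / 2) ^ (4 * (m + 1) * d)
      = 2 ^ (m - 1) * ((1 - (d : ℝ)⁻¹ / 2) ^ (2 * d)) ^ (2 * (m + 1)) := by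
        rw [← pow_mul]
        congr 2
        ring
    _ ≤ 2 ^ (m + 1) * (1 / 2) ^ (2 * (m + 1)) := by
        have : 0 ≤ (1 - (d : ℝ)⁻¹ / 2) ^ (2 * d) := pow_nonneg (by linarith) _
        gcongr
        · norm_num
        · omega
    _ = (1 / 2) ^ (m + 1) := by
        rw [two_mul, pow_add (1 / 2 : ℝ), ← mul_assoc, ← mul_pow]
        norm_num
    _ ≤ (1 / 2) ^ 2 := pow_le_pow_of_le_one (by norm_num) (by norm_num) (by omega)
    _ ≤ 1 / 3 := by norm_num

theorem stmt_2 :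
    ∃ C c : ℝ, 0 < C ∧ 0 < c ∧
      ∀ n d : ℕ, 4 ≤ n → 2 ≤ d →
        ∃ (M : Canonical (Fin n)) (a b : Fin n),
          AQC M a b ≤ ENNReal.ofReal (C * (n : ℝ) ^ 2 * d) ∧
          ENNReal.ofReal
              (c * min ((d : ℝ) ^ n)
                ((d : ℝ) ^ (n - 2) * ((2 * Real.exp 1 * Real.log d) ^ n)⁻¹)) ≤
            NAQC M a b := by
  refine ⟨4, 1 / 3, by norm_num, by norm_num, fun n d hn hd => ?_⟩
  obtain ⟨m, rfl⟩ : ∃ m, n = m + 1 := ⟨n - 1, by omega⟩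
  have hd2 : (2 : ℝ) ≤ d := by exact_mod_cast hd
  have h0 : 0 ≤ (d : ℝ)⁻¹ := by positivity
  have h1 : (d : ℝ)⁻¹ ≤ 1 := inv_le_one_of_one_le₀ (by linarith)
  refine ⟨decayChain m (d : ℝ)⁻¹ h0 h1, ⟨m, by omega⟩, ⟨m - 1, by omega⟩, ?_, ?_⟩
  · refine (iInf_le _ retry).trans ((QC_le (T := 4 * (m + 1) * d) ?_).trans ?_)
    · refine le_trans ?_ (le_obsTV_retry h0 h1 (by omega) rfl rfl _)
      have := two_pow_mul_one_sub_pow_le (m := m) (d := d) (by omega) (by omega)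
      linarith
    · rw [← ENNReal.ofReal_natCast]
      refine ENNReal.ofReal_le_ofReal ?_
      push_cast
      have : (1 : ℝ) ≤ m + 1 := by
        have : (0 : ℝ) ≤ m := Nat.cast_nonneg m
        linarith
      gcongr
      nlinarith
  · refine le_iInf fun A => le_sInf ?_
    rintro _ ⟨T, rfl, hT⟩
    rw [← ENNReal.ofReal_natCast]
    refine ENNReal.ofReal_le_ofReal ?_
    have hTV := hT.trans (obsTV_le_of_nonAdaptive h0 h1 A.2 (by omega) rfl rfl T)
    have hpow : 1 / 3 * (d : ℝ) ^ (m - 1) ≤ T := by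
      rw [inv_pow, ← div_eq_mul_inv, le_div_iff₀ (by positivity)] at hTV
      exact hTV
    refine le_trans ?_ hpow
    refine mul_le_mul_of_nonneg_left ((min_le_right _ _).trans ?_) (by norm_num)
    refine mul_le_of_le_one_right (by positivity) (inv_le_one_of_one_le₀ (one_le_pow₀ ?_))
    have hlog : 0.6931471803 < Real.log d :=
      Real.log_two_gt_d9.trans_le (Real.log_le_log (by norm_num) hd2)
    have he := Real.add_one_le_exp (1 : ℝ)
    nlinarith
end

section
/- Let Ω be a finite set with |Ω| = n ≥ 2, let P assign to each x ∈ Ω a probability distribution P(·|x) on Ω, let 𝒫 be a partition of Ω, and let a, b ∈ Ω satisfy 𝒫(a) = 𝒫(b) and d_TV^𝒫(a,b) > 0. Then there exists a partition 𝒫' of Ω that refines 𝒫 such that 𝒫'(a) ≠ 𝒫'(b) and every pair of states x, y ∈ Ω with 𝒫(x) = 𝒫(y) and 𝒫'(x) ≠ 𝒫'(y) satisfies d_TV^𝒫(x,y) ≥ d_TV^𝒫(a,b)/(n−1); in particular w(𝒫, 𝒫') ≤ ((n−1)/d_TV^𝒫(a,b))². -/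
open Finset
open scoped ENNReal

/-- A partition of a finite type `Ω`, given by the map sending each element to its class. -/
structure Partn (Ω : Type) [Fintype Ω] [DecidableEq Ω] where
  cls : Ω → Finset Ω
  mem_cls : ∀ x, x ∈ cls x
  cls_eq : ∀ x y, y ∈ cls x → cls y = cls x

/-- `probOf P x C = P(C|x)`, the probability that the next state after `x` lies in `C`. -/
noncomputable def probOf {Ω : Type} [Fintype Ω] (P : Ω → Ω → ℝ) (x : Ω) (C : Finset Ω) : ℝ :=
  ∑ y ∈ C, P x y

/-- Projected total variation distance `d_TV^Pt(a,b)`. -/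
noncomputable def dTVP {Ω : Type} [Fintype Ω] [DecidableEq Ω] (P : Ω → Ω → ℝ)
    (Pt : Partn Ω) (a b : Ω) : ℝ :=
  (1 / 2) * ∑ C ∈ Finset.univ.image Pt.cls, |probOf P a C - probOf P b C|

/-- `Pt'` refines `Pt` if every class of `Pt'` is contained in a class of `Pt`. -/
def Refines {Ω : Type} [Fintype Ω] [DecidableEq Ω] (Pt' Pt : Partn Ω) : Prop :=
  ∀ x, Pt'.cls x ⊆ Pt.cls x

/-- The weight `w(Pt,Pt')`: the maximum of `1/d_TV^Pt(x,y)²` over pairs `x, y` lying in the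
same class of `Pt` but different classes of `Pt'` (valued in `ℝ≥0∞`; `1/0 = ⊤`). -/
noncomputable def wgt {Ω : Type} [Fintype Ω] [DecidableEq Ω] (P : Ω → Ω → ℝ)
    (Pt Pt' : Partn Ω) : ℝ≥0∞ :=
  ⨆ (x : Ω) (y : Ω) (_ : Pt.cls x = Pt.cls y ∧ Pt'.cls x ≠ Pt'.cls y),
    (ENNReal.ofReal ((dTVP P Pt x y) ^ 2))⁻¹

theorem dTVP_self {Ω : Type} [Fintype Ω] [DecidableEq Ω] (P : Ω → Ω → ℝ) (Pt : Partn Ω) (x : Ω) :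
    dTVP P Pt x x = 0 := by
  simp [dTVP]

theorem dTVP_comm {Ω : Type} [Fintype Ω] [DecidableEq Ω] (P : Ω → Ω → ℝ) (Pt : Partn Ω)
    (x y : Ω) : dTVP P Pt x y = dTVP P Pt y x := by
  simp only [dTVP, abs_sub_comm]

theorem dTVP_triangle {Ω : Type} [Fintype Ω] [DecidableEq Ω] (P : Ω → Ω → ℝ) (Pt : Partn Ω)
    (x y z : Ω) : dTVP P Pt x z ≤ dTVP P Pt x y + dTVP P Pt y z := by
  unfold dTVP
  rw [← mul_add, ← Finset.sum_add_distrib]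
  gcongr
  exact abs_sub_le _ _ _

/-- The graph joining distinct states of the same class of `Pt` at projected distance less
than `δ`. -/
def closeGraph {Ω : Type} [Fintype Ω] [DecidableEq Ω] (P : Ω → Ω → ℝ) (Pt : Partn Ω) (δ : ℝ) :
    SimpleGraph Ω where
  Adj x y := x ≠ y ∧ Pt.cls x = Pt.cls y ∧ dTVP P Pt x y < δ
  symm := ⟨fun x y h => ⟨h.1.symm, h.2.1.symm, dTVP_comm P Pt x y ▸ h.2.2⟩⟩
  loopless := ⟨fun _ h => h.1 rfl⟩

theorem closeGraph_walk {Ω : Type} [Fintype Ω] [DecidableEq Ω] {P : Ω → Ω → ℝ} {Pt : Partn Ω}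
    {δ : ℝ} (hδ : 0 ≤ δ) {x y : Ω} (p : (closeGraph P Pt δ).Walk x y) :
    Pt.cls x = Pt.cls y ∧ (x = y ∨ dTVP P Pt x y < p.length * δ) := by
  induction p with
  | nil => exact ⟨rfl, Or.inl rfl⟩
  | @cons u v w h p ih =>
    have hcls : Pt.cls u = Pt.cls v := h.2.1
    have hlt : dTVP P Pt u v < δ := h.2.2
    refine ⟨hcls.trans ih.1, Or.inr ?_⟩
    have hnn : 0 ≤ (p.length : ℝ) * δ := by positivity
    rw [SimpleGraph.Walk.length_cons]
    push_cast
    rcases ih.2 with rfl | hvw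
    · linarith
    · linarith [dTVP_triangle P Pt u v w]

/-- The partition of a finite type into the connected components of a graph. -/
noncomputable def componentPartn {Ω : Type} [Fintype Ω] [DecidableEq Ω] (G : SimpleGraph Ω) :
    Partn Ω :=
  open Classical in
  { cls := fun x => Finset.univ.filter (G.Reachable x)
    mem_cls := fun x => by simp
    cls_eq := fun x y h => by
      have hxy : G.Reachable x y := by simpa using h
      ext z
      simpa using ⟨hxy.trans, hxy.symm.trans⟩ }

theorem mem_componentPartn {Ω : Type} [Fintype Ω] [DecidableEq Ω] {G : SimpleGraph Ω} {x y : Ω} :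
    y ∈ (componentPartn G).cls x ↔ G.Reachable x y := by
  simp [componentPartn]

theorem componentPartn_cls_eq_iff {Ω : Type} [Fintype Ω] [DecidableEq Ω] {G : SimpleGraph Ω}
    {x y : Ω} : (componentPartn G).cls x = (componentPartn G).cls y ↔ G.Reachable x y := by
  refine ⟨fun h => ?_, fun h => ((componentPartn G).cls_eq x y (mem_componentPartn.2 h)).symm⟩
  exact mem_componentPartn.1 (h ▸ (componentPartn G).mem_cls y)

theorem wgt_le {Ω : Type} [Fintype Ω] [DecidableEq Ω] {P : Ω → Ω → ℝ} {Pt Pt' : Partn Ω}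
    {δ : ℝ} (hδ : 0 < δ)
    (h : ∀ x y : Ω, Pt.cls x = Pt.cls y → Pt'.cls x ≠ Pt'.cls y → δ ≤ dTVP P Pt x y) :
    wgt P Pt Pt' ≤ ENNReal.ofReal (δ⁻¹ ^ 2) := by
  refine iSup_le fun x => iSup_le fun y => iSup_le fun hxy => ?_
  rw [inv_pow, ENNReal.ofReal_inv_of_pos (by positivity)]
  have := h x y hxy.1 hxy.2
  gcongr

theorem stmt_5 {Ω : Type} [Fintype Ω] [DecidableEq Ω] (n : ℕ) (hn : 2 ≤ n)
    (hcard : Fintype.card Ω = n)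
    (P : Ω → Ω → ℝ) (hP0 : ∀ x y, 0 ≤ P x y) (hP1 : ∀ x, ∑ y, P x y = 1)
    (Pt : Partn Ω) (a b : Ω) (hab : Pt.cls a = Pt.cls b) (hd : 0 < dTVP P Pt a b) :
    ∃ Pt' : Partn Ω, Refines Pt' Pt ∧ Pt'.cls a ≠ Pt'.cls b ∧
      (∀ x y : Ω, Pt.cls x = Pt.cls y → Pt'.cls x ≠ Pt'.cls y →
        dTVP P Pt a b / ((n : ℝ) - 1) ≤ dTVP P Pt x y) ∧
      wgt P Pt Pt' ≤ ENNReal.ofReal ((((n : ℝ) - 1) / dTVP P Pt a b) ^ 2) := by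
  have hn1 : (0 : ℝ) < (n : ℝ) - 1 := by
    have : (2 : ℝ) ≤ n := by exact_mod_cast hn
    linarith
  have hδ : 0 < dTVP P Pt a b / ((n : ℝ) - 1) := div_pos hd hn1
  set δ := dTVP P Pt a b / ((n : ℝ) - 1) with hδ_def
  have hsep : ∀ x y : Ω, Pt.cls x = Pt.cls y →
      (componentPartn (closeGraph P Pt δ)).cls x ≠ (componentPartn (closeGraph P Pt δ)).cls y →
      δ ≤ dTVP P Pt x y := by
    intro x y hxy hne
    by_contra! hlt
    refine hne (componentPartn_cls_eq_iff.2 ?_)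
    exact SimpleGraph.Adj.reachable ⟨fun h => hne (h ▸ rfl), hxy, hlt⟩
  refine ⟨componentPartn (closeGraph P Pt δ), ?_, ?_, hsep, ?_⟩
  · intro x y hy
    obtain ⟨p⟩ := mem_componentPartn.1 hy
    exact (closeGraph_walk hδ.le p).1 ▸ Pt.mem_cls y
  · intro h
    obtain ⟨p, hp⟩ := (componentPartn_cls_eq_iff.1 h).exists_isPath
    have hlen : (p.length : ℝ) ≤ (n : ℝ) - 1 := by
      have : p.length + 1 ≤ n := hcard ▸ hp.length_lt
      have : (p.length : ℝ) + 1 ≤ n := by exact_mod_cast this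
      linarith
    rcases (closeGraph_walk hδ.le p).2 with rfl | hlt
    · exact hd.ne' (dTVP_self P Pt a)
    · have h1 := mul_le_mul_of_nonneg_right hlen hδ.le
      have h2 : ((n : ℝ) - 1) * δ = dTVP P Pt a b := mul_div_cancel₀ _ hn1.ne'
      linarith
  · rw [← inv_div]
    exact wgt_le hδ hsep
end
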